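/- **Source.** A data schema has typed data (each type $S$ with a domain and a constant $\mathtt{undef}_S$), a finite catalog of read-only relations $R(id,A_1,\dots,A_n)$ with single-column keys of pairwise different types and with foreign keys, a finite repository of updatable relations $R(A_1,\dots,A_n)$, $n\ge 1$, and finitely many typed case variables, among them $\mathit{self}$. A *cube* is a conjunction of equations $t=t'$, catalog atoms, repository atoms, and negations of such atoms, whose arguments are variables, case variables or constants; a *guard* is a finite disjunction of cubes with answer variables; a *condition* is a Boolean combination of equations. An *effect* is a set rule $\mathtt{SET}\ x_1=v_1,\dots$ (distinct case variables other than $\mathit{self}$), a rule $\mathtt{INSERT}\ \vec u\ \mathtt{INTO}\ R\ \mathtt{AND\ SET}\dots$, a rule $\mathtt{DEL}\ \vec u\ \mathtt{FROM}\ R\ \mathtt{AND\ SET}\dots$, or a conditional update $\mathtt{UPDATE}\ R(\vec v)\ \mathtt{IF}\ \psi\ \mathtt{THEN}\ \eta_1\ \mathtt{ELSE}\ \eta_2$ with repository-free guards $\psi$ as filters, where each $\eta_i$ is $R(\vec u')$ or a nested if-then-else. A *DAB* is a data schema with a finite tree of blocks rooted at a process block: empty blocks, atomic and nonatomic tasks,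 events, process and subprocess blocks, (iterated) sequences, parallel, inclusive, exclusive and deferred choice blocks, loops, blocks with errors, "error or event" blocks, and backward, forward and non-interrupting exception handlers. Errors are caught at an enclosing block that carries the boundary event of a backward or forward handler. The translation of a block $B$ produces the rules "if Guard then Update", for a process instance $I$, that describe one step of the lifecycle of $B$ and its nested blocks. The guard is a conjunction of a cube and conditions in which each case variable $v$ is replaced by $v[I]$, of lifecycle equations $\mathit{lifecycleStateC}[I]=\ell$, and possibly of an equation $\mathit{errorA}=b$. The update consists of at most one effect with $v$ replaced by $v[I]$, of assignments $\mathit{lifecycleStateC}'[I]=\ell$, and possibly of assignments to Boolean error flags. A task whose precondition has several disjuncts produces one rule for each disjunct. **Target.** The basic sorts are the types of the schema together with a sort of lifecycle labels and a Boolean sort; the function symbols are $f_{R,A_k}$ for each catalog relation $R$ and non-key attribute $A_k$; $T$ consists of the axioms $\forall x\,(x=\mathtt{undef}\leftrightarrow f(x)=\mathtt{undef})$. The artifact sorts are $PI_{index}$ and one sort $R_{index}$ for each repository relation $R$. The artifact components $a$ are $a_v$ (for each case variable $v$), $\mathit{lifecycleStateB}$ and $\mathit{errorB}$ (for each block $B$),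 with source $PI_{index}$, and $a_{R_k}$ (for each attribute of each repository relation $R$), with source $R_{index}$. The artifact variables $x$ are the un-indexed Boolean variables $\mathit{errorA}$. A *$T$-partition* is a finite list of quantifier-free formulae that are, modulo $T$, jointly exhaustive and pairwise exclusive; an expression $F$ is *case-defined* if there are a $T$-partition $\kappa_1,\dots,\kappa_n$ and terms $t_1,\dots,t_n$, over the same variables, with $T\models\kappa_i\to F=t_i$ for all $i$. **Rewriting of a rule.** * $v[I]$ becomes $a_v[i]$ (and likewise for the control components). * A repository atom $R(\vec t)$ of the guard becomes $\bigwedge_k a_{R_k}[e]=t_k$ with a fresh $e$ of sort $R_{index}$. * A catalog atom $R(t_0,\dots,t_n)$ becomes $t_0\ne\mathtt{undef}\wedge\bigwedge_k t_k=f_{R,A_k}(t_0)$. * An insertion becomes $a_R'=\lambda j.(\text{if } j=e_{ins}\text{ then }\vec u\text{ else }a_R[j])$ in the multiset semantics; in the set semantics the else-branch is "if $a_R[j]=\vec u$ then $\mathtt{undef}$ else $a_R[j]$". In both cases $a_R[e_{ins}]=\mathtt{undef}$ is added to the guard. * A deletion becomes $a_R'=\lambda j.(\text{if }j=e_{del}\text{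 then }\mathtt{undef}\text{ else }a_R[j])$, and $a_R[e_{del}]=\vec u$ is added to the guard. * A conditional update becomes $a_R'=\lambda j.(\text{the (nested) if-then-else with each }v_k\text{ replaced by }a_{R_k}[j])$. * An assignment $w'[I]=t$ becomes $a_w'=\lambda j.(\text{if }j=i\text{ then }t\text{ else }a_w[j])$. * Artifact variables and components that are not mentioned keep their values. Let $G$ and $U$ be the rewritten guard and update. **Claim.** For every DAB, every choice of set or multiset semantics for each repository relation, every block and every rule produced by the translation of that block, the formula obtained by the rewriting has the form $$\exists \underline e_{ins}\,\exists \underline e_{del}\,\exists \underline e\,\exists i\,\exists \underline y\,(G\wedge U),$$ where $\underline e_{ins},\underline e_{del},\underline e$ are variables of sorts $R_{index}$, $i$ is a variable of sort $PI_{index}$, the $\underline y$ are variables of basic sorts (the non-case variables that occur in the rule), and $G$ is quantifier-free. It is moreover a transition formula of relational artifact systems, i.e. it has the form $$\exists \underline e\,\Bigl(\gamma(\underline e,\underline x,\underline a)\wedge\bigwedge_i x_i'=F_i(\underline e,\underline x,\underline a)\wedge\bigwedge_j a_j'=\lambda y.\,G_j(y,\underline e,\underline x,\underline a)\Bigr)$$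 with a quantifier-free guard $\gamma$, exactly one update for each artifact variable and each artifact component, and case-defined updates $F_i$, $G_j$. Both assertions remain true after each quantifier $\exists y$ whose variable has a defining conjunct $a_{R_k}[e]=y$ in $G$ has been eliminated by substituting $a_{R_k}[e]$ for $y$. -/

import Mathlib

/-! ## Part 1: relational artifact systems (the target formalism) -/

namespace RAS

/-- The symbols of an array-based relational artifact system.  `Basic` are the sorts of the DB
signature (whose only symbols are constants, among them one `undef` per sort, and unary functions);
`Art` are the artifact sorts added by the artifact extension; `AVar` and `Comp` are the artifact
variables and the artifact components of the artifact setting, the latter with an artifact sort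
as source and a basic sort as target. -/
structure Signature where
  Basic : Type
  Art : Type
  Const : Basic → Type
  undef : (s : Basic) → Const s
  Fn : Type
  fnSrc : Fn → Basic
  fnTgt : Fn → Basic
  AVar : Type
  avSort : AVar → Basic ⊕ Art
  Comp : Type
  compSrc : Comp → Art
  compTgt : Comp → Basic

/-- All sorts of the artifact extension. -/
abbrev Signature.Srt (S : Signature) : Type := S.Basic ⊕ S.Art

/-- An expression is a term of some sort or a formula. -/
inductive Kind (σ : Type) : Type
  | tm (s : σ)
  | fm

/-- `cur` marks the artifact variables and components `x`, `a`; `next` marks their renamed copies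
`x'`, `a'`. -/
inductive Copy : Type
  | cur
  | next

/-- Many-sorted first-order terms and formulae over the signature, the unprimed and primed artifact
variables and components, and sorted individual variables `n : s` with names `n : N`; terms may
also be built with if-then-else. -/
inductive Syn (S : Signature) (N : Type) : Kind S.Srt → Type
  | var (s : S.Srt) (n : N) : Syn S N (.tm s)
  | const (s : S.Basic) (c : S.Const s) : Syn S N (.tm (.inl s))
  | app (f : S.Fn) (t : Syn S N (.tm (.inl (S.fnSrc f)))) : Syn S N (.tm (.inl (S.fnTgt f)))
  | avar (p : Copy) (x : S.AVar) : Syn S N (.tm (S.avSort x))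
  | read (p : Copy) (a : S.Comp) (t : Syn S N (.tm (.inr (S.compSrc a)))) :
      Syn S N (.tm (.inl (S.compTgt a)))
  | ite {s : S.Srt} (c : Syn S N .fm) (t u : Syn S N (.tm s)) : Syn S N (.tm s)
  | eq {s : S.Srt} (t u : Syn S N (.tm s)) : Syn S N .fm
  | tru : Syn S N .fm
  | neg (φ : Syn S N .fm) : Syn S N .fm
  | and (φ ψ : Syn S N .fm) : Syn S N .fm
  | ex (s : S.Srt) (n : N) (φ : Syn S N .fm) : Syn S N .fm
  | all (s : S.Srt) (n : N) (φ : Syn S N .fm) : Syn S N .fm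

abbrev Term (S : Signature) (N : Type) (s : S.Srt) : Type := Syn S N (.tm s)
abbrev Formula (S : Signature) (N : Type) : Type := Syn S N .fm

variable {S : Signature} {N : Type}

/-- `φ ∨ ψ`, the usual abbreviation. -/
def Syn.or (φ ψ : Formula S N) : Formula S N := .neg (.and (.neg φ) (.neg ψ))

/-- Finite conjunction. -/
def conj (l : List (Formula S N)) : Formula S N := l.foldr Syn.and .tru

/-- Finite disjunction. -/
def disj (l : List (Formula S N)) : Formula S N := l.foldr Syn.or (.neg .tru)

/-- A block of existential quantifiers over individual variables. -/
def exs (vs : List (S.Srt × N)) (φ : Formula S N) : Formula S N :=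
  vs.foldr (fun v ψ => .ex v.1 v.2 ψ) φ

/-! ### Syntactic classes -/

/-- No quantifier occurs. -/
def Syn.QuantifierFree : {k : Kind S.Srt} → Syn S N k → Prop
  | _, .var _ _ => True
  | _, .const _ _ => True
  | _, .app _ t => t.QuantifierFree
  | _, .avar _ _ => True
  | _, .read _ _ t => t.QuantifierFree
  | _, .ite c t u => c.QuantifierFree ∧ t.QuantifierFree ∧ u.QuantifierFree
  | _, .eq t u => t.QuantifierFree ∧ u.QuantifierFree
  | _, .tru => True
  | _, .neg φ => φ.QuantifierFree
  | _, .and φ ψ => φ.QuantifierFree ∧ ψ.QuantifierFree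
  | _, .ex _ _ _ => False
  | _, .all _ _ _ => False

/-- No if-then-else occurs. -/
def Syn.IteFree : {k : Kind S.Srt} → Syn S N k → Prop
  | _, .var _ _ => True
  | _, .const _ _ => True
  | _, .app _ t => t.IteFree
  | _, .avar _ _ => True
  | _, .read _ _ t => t.IteFree
  | _, .ite _ _ _ => False
  | _, .eq t u => t.IteFree ∧ u.IteFree
  | _, .tru => True
  | _, .neg φ => φ.IteFree
  | _, .and φ ψ => φ.IteFree ∧ ψ.IteFree
  | _, .ex _ _ φ => φ.IteFree
  | _, .all _ _ φ => φ.IteFree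

/-- The free individual variables lie in `V` and no primed symbol occurs: the expression has the
form `φ(v, x, a)` with `v` ranging over `V`. -/
def Syn.Over : {k : Kind S.Srt} → Syn S N k → Set (S.Srt × N) → Prop
  | _, .var s n, V => (s, n) ∈ V
  | _, .const _ _, _ => True
  | _, .app _ t, V => t.Over V
  | _, .avar p _, _ => p = .cur
  | _, .read p _ t, V => p = .cur ∧ t.Over V
  | _, .ite c t u, V => c.Over V ∧ t.Over V ∧ u.Over V
  | _, .eq t u, V => t.Over V ∧ u.Over V
  | _, .tru, _ => True
  | _, .neg φ, V => φ.Over V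
  | _, .and φ ψ, V => φ.Over V ∧ ψ.Over V
  | _, .ex s n φ, V => φ.Over (insert (s, n) V)
  | _, .all s n φ, V => φ.Over (insert (s, n) V)

/-! ### Semantics -/

/-- A structure for the DB signature together with the artifact sorts. -/
structure Struc (S : Signature) where
  carrier : S.Srt → Type
  nonempty : ∀ s, Nonempty (carrier s)
  const : (s : S.Basic) → S.Const s → carrier (.inl s)
  fn : (f : S.Fn) → carrier (.inl (S.fnSrc f)) → carrier (.inl (S.fnTgt f))

/-- Models of the DB theory `T`, which consists of the axioms
`∀ x (x = undef ↔ f(x) = undef)`, one for each function symbol `f`. -/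
def Struc.IsModel (M : Struc S) : Prop :=
  ∀ (f : S.Fn) (x : M.carrier (.inl (S.fnSrc f))),
    x = M.const _ (S.undef _) ↔ M.fn f x = M.const _ (S.undef _)

/-- Assignments to individual variables and to both copies of the artifact setting. -/
structure Asg (M : Struc S) (N : Type) where
  var : (s : S.Srt) → N → M.carrier s
  avar : Copy → (x : S.AVar) → M.carrier (S.avSort x)
  comp : Copy → (a : S.Comp) → M.carrier (.inr (S.compSrc a)) → M.carrier (.inl (S.compTgt a))

open Classical in
/-- Reassign one individual variable. -/
noncomputable def Asg.set {M : Struc S} (α : Asg M N) (s : S.Srt) (n : N) (d : M.carrier s) :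
    Asg M N :=
  { α with var := fun s' n' => if h : s = s' ∧ n' = n then h.1 ▸ d else α.var s' n' }

/-- Terms denote elements, formulae denote truth values. -/
abbrev Kind.Den (M : Struc S) : Kind S.Srt → Type
  | .tm s => M.carrier s
  | .fm => Prop

open Classical in
/-- Evaluation of terms and truth of formulae. -/
noncomputable def Syn.eval (M : Struc S) : {k : Kind S.Srt} → Syn S N k → Asg M N → k.Den M
  | _, .var s n, α => α.var s n
  | _, .const s c, _ => M.const s c
  | _, .app f t, α => M.fn f (t.eval M α)
  | _, .avar p x, α => α.avar p x
  | _, .read p a t, α => α.comp p a (t.eval M α)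
  | _, .ite (s := s) c t u, α =>
      (if (c.eval M α : Prop) then t.eval M α else u.eval M α : M.carrier s)
  | _, .eq (s := s) t u, α => ((t.eval M α : M.carrier s) = u.eval M α : Prop)
  | _, .tru, _ => True
  | _, .neg φ, α => ¬ (φ.eval M α : Prop)
  | _, .and φ ψ, α => (φ.eval M α : Prop) ∧ (ψ.eval M α : Prop)
  | _, .ex s n φ, α => ∃ d : M.carrier s, (φ.eval M (α.set s n d) : Prop)
  | _, .all s n φ, α => ∀ d : M.carrier s, (φ.eval M (α.set s n d) : Prop)

/-- Truth of a formula. -/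
def Holds (M : Struc S) (α : Asg M N) (φ : Formula S N) : Prop := φ.eval M α

/-- `T ⊨ φ`: truth in all models of the DB theory under all assignments. -/
def Entails (φ : Formula S N) : Prop :=
  ∀ M : Struc S, M.IsModel → ∀ α : Asg M N, Holds M α φ

/-! ### Case-defined functions and transition formulae -/

/-- A `T`-partition: finitely many quantifier-free formulae that are, modulo `T`, jointly
exhaustive and pairwise exclusive. -/
def IsTPartition (κ : List (Formula S N)) : Prop :=
  (∀ φ ∈ κ, φ.QuantifierFree ∧ φ.IteFree) ∧
  Entails (disj κ) ∧
  κ.Pairwise (fun φ ψ => Entails (.neg (.and φ ψ)))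

/-- The expression `F` is a case-defined function `F(v, x, a)` of the individual variables in `V`
and of the current artifact setting: there are a `T`-partition `κ₁, …, κₙ` and terms
`t₁, …, tₙ` over `V`, `x`, `a` with `T ⊨ κᵢ → F = tᵢ` for all `i`. -/
def IsCaseDefined (V : Set (S.Srt × N)) {s : S.Srt} (F : Term S N s) : Prop :=
  F.Over V ∧
  ∃ cases : List (Formula S N × Term S N s),
    IsTPartition (cases.map Prod.fst) ∧
    ∀ c ∈ cases,
      c.1.Over V ∧ c.2.Over V ∧ c.2.QuantifierFree ∧ c.2.IteFree ∧
      ∀ M : Struc S, M.IsModel → ∀ α : Asg M N, Holds M α c.1 → F.eval M α = c.2.eval M α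

/-- The formula `x' = F`. -/
def avarUpdate (x : S.AVar) (F : Term S N (S.avSort x)) : Formula S N :=
  .eq (.avar .next x) F

/-- The formula `a' = λ y. G`, that is `∀ y. a'(y) = G`. -/
def compUpdate (a : S.Comp) (y : N) (G : Term S N (.inl (S.compTgt a))) : Formula S N :=
  .all (.inr (S.compSrc a)) y (.eq (.read .next a (.var _ y)) G)

/-- `φ` is a transition formula
`∃ e (γ(e,x,a) ∧ ⋀ᵢ x'ᵢ = Fᵢ(e,x,a) ∧ ⋀ⱼ a'ⱼ = λ y. Gⱼ(y,e,x,a))`: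
`γ` is quantifier-free, there is exactly one update for each artifact variable and for each
artifact component of the artifact setting, and all the updates are case-defined. -/
def IsTransitionFormula (φ : Formula S N) : Prop :=
  ∃ (e : List (S.Srt × N)) (γ : Formula S N)
    (F : List ((x : S.AVar) × Term S N (S.avSort x)))
    (y : S.Comp → N)
    (G : List ((a : S.Comp) × Term S N (.inl (S.compTgt a)))),
    e.Nodup ∧
    γ.QuantifierFree ∧ γ.IteFree ∧ γ.Over {v | v ∈ e} ∧
    (F.map Sigma.fst).Nodup ∧ (∀ x, x ∈ F.map Sigma.fst) ∧
    (∀ f ∈ F, IsCaseDefined {v | v ∈ e} f.2) ∧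
    (G.map Sigma.fst).Nodup ∧ (∀ a, a ∈ G.map Sigma.fst) ∧
    (∀ g ∈ G, (Sum.inr (S.compSrc g.1), y g.1) ∉ e ∧
      IsCaseDefined (insert (Sum.inr (S.compSrc g.1), y g.1) {v | v ∈ e}) g.2) ∧
    φ = exs e (.and γ (.and
          (conj (F.map fun f => avarUpdate f.1 f.2))
          (conj (G.map fun g => compUpdate g.1 (y g.1) g.2))))

/-! ### Substitution -/

/-- The conjuncts of a formula. -/
def Syn.conjuncts : Formula S N → List (Formula S N)
  | .and φ ψ => φ.conjuncts ++ ψ.conjuncts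
  | .eq t u => [.eq t u]
  | .tru => [.tru]
  | .neg φ => [.neg φ]
  | .ex s n φ => [.ex s n φ]
  | .all s n φ => [.all s n φ]

open Classical in
/-- Replace the free occurrences of the variables `n : s` by the terms `σ s n`. -/
noncomputable def Syn.subst : {k : Kind S.Srt} → Syn S N k → ((s : S.Srt) → N → Term S N s) →
    Syn S N k
  | _, .var s n, σ => σ s n
  | _, .const s c, _ => .const s c
  | _, .app f t, σ => .app f (t.subst σ)
  | _, .avar p x, _ => .avar p x
  | _, .read p a t, σ => .read p a (t.subst σ)
  | _, .ite c t u, σ => .ite (c.subst σ) (t.subst σ) (u.subst σ)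
  | _, .eq t u, σ => .eq (t.subst σ) (u.subst σ)
  | _, .tru, _ => .tru
  | _, .neg φ, σ => .neg (φ.subst σ)
  | _, .and φ ψ, σ => .and (φ.subst σ) (ψ.subst σ)
  | _, .ex s n φ, σ =>
      .ex s n (φ.subst fun s' n' => if s' = s ∧ n' = n then .var s' n' else σ s' n')
  | _, .all s n φ, σ =>
      .all s n (φ.subst fun s' n' => if s' = s ∧ n' = n then .var s' n' else σ s' n')

end RAS

/-! ## Part 2: data-aware BPMN (the source formalism) -/

namespace DABModel

/-- A data schema: types (primitive and id types) with their domains and undefined values, a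
catalog, the case identifier type, a repository, and the case variables.  A catalog relation `R`
has the key attribute, of type `catKey R`, followed by `catArity R` further attributes. -/
structure DataSchema where
  ValTy : Type
  IdTy : Type
  Dom : ValTy ⊕ IdTy → Type
  undef : (s : ValTy ⊕ IdTy) → Dom s
  Cat : Type
  [catFintype : Fintype Cat]
  catKey : Cat → IdTy
  catArity : Cat → ℕ
  catAttr : (R : Cat) → Fin (catArity R) → ValTy ⊕ IdTy
  catKey_injective : Function.Injective catKey
  cat_foreignKey : ∀ R k S, catAttr R k = .inr S → ∃ R₂, catKey R₂ = S
  CType : IdTy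
  cType_disjoint : ∀ R, catKey R ≠ CType
  Repo : Type
  [repoFintype : Fintype Repo]
  repoArity : Repo → ℕ
  repoArity_pos : ∀ R, 0 < repoArity R
  repoAttr : (R : Repo) → Fin (repoArity R) → ValTy ⊕ IdTy
  repo_foreignKey : ∀ R k S, repoAttr R k = .inr S → (∃ R₂, catKey R₂ = S) ∨ S = CType
  CVar : Type
  [cvarFintype : Fintype CVar]
  cvSort : CVar → ValTy ⊕ IdTy
  cvar_foreignKey : ∀ x S, cvSort x = .inr S → (∃ R₂, catKey R₂ = S) ∨ S = CType
  self : CVar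
  self_sort : cvSort self = .inr CType

attribute [instance] DataSchema.catFintype DataSchema.repoFintype DataSchema.cvarFintype

abbrev DataSchema.Ty (D : DataSchema) : Type := D.ValTy ⊕ D.IdTy

/-- Normal (non-case) typed variables: countably many of each type. -/
abbrev NVar (D : DataSchema) : Type := D.Ty × ℕ

/-- The elements of queries and effects: normal variables, case variables, constant objects. -/
inductive DTm (D : DataSchema) : D.Ty → Type
  | var (s : D.Ty) (n : ℕ) : DTm D s
  | cvar (x : D.CVar) : DTm D (D.cvSort x)
  | const (s : D.Ty) (d : D.Dom s) : DTm D s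

/-- The elements of extended guards and updates: each case variable `v` is replaced by a term
`v[I]`, where `I` is a process instance; process instances are numbered. -/
inductive ETm (D : DataSchema) : D.Ty → Type
  | var (s : D.Ty) (n : ℕ) : ETm D s
  | inst (x : D.CVar) (I : ℕ) : ETm D (D.cvSort x)
  | const (s : D.Ty) (d : D.Dom s) : ETm D s

/-- The substitution of `v[I]` for every case variable `v`. -/
def DTm.ext {D : DataSchema} (I : ℕ) : (s : D.Ty) → DTm D s → ETm D s
  | _, .var s n => .var s n
  | _, .cvar x => .inst x I
  | _, .const s d => .const s d

/-- The normal variables of a term. -/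
def DTm.nvars {D : DataSchema} : {s : D.Ty} → DTm D s → List (NVar D)
  | _, .var s n => [(s, n)]
  | _, .cvar _ => []
  | _, .const _ _ => []

def ETm.nvars {D : DataSchema} : {s : D.Ty} → ETm D s → List (NVar D)
  | _, .var s n => [(s, n)]
  | _, .inst _ _ => []
  | _, .const _ _ => []

/-! The query and update languages are defined over an arbitrary family `T` of terms; they are used
for `T = DTm D` (the language of the process) and for `T = ETm D` (its extended version). -/

/-- Equality atoms and catalog atoms. -/
inductive BaseAtom (D : DataSchema) (T : D.Ty → Type) : Type
  | eq (s : D.Ty) (t u : T s)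
  | cat (R : D.Cat) (t₀ : T (.inr (D.catKey R))) (t : (k : Fin (D.catArity R)) → T (D.catAttr R k))

/-- Atoms of queries: also repository atoms. -/
inductive Atom (D : DataSchema) (T : D.Ty → Type) : Type
  | base (A : BaseAtom D T)
  | repo (R : D.Repo) (t : (k : Fin (D.repoArity R)) → T (D.repoAttr R k))

/-- An atom or, if `pos = false`, a negated atom. -/
structure Lit (A : Type) where
  pos : Bool
  atom : A

/-- A conjunctive query with filters: a conjunction of atoms and negated atoms. -/
abbrev Cube (D : DataSchema) (T : D.Ty → Type) : Type := List (Lit (Atom D T))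

/-- Conditions `φ ::= x = y | ¬ φ | φ ∧ φ`. -/
inductive Cond (D : DataSchema) (T : D.Ty → Type) : Type
  | eq (s : D.Ty) (t u : T s)
  | neg (φ : Cond D T)
  | and (φ ψ : Cond D T)

/-- Terms inside a conditional update of `R(v)`: ordinary terms, and the new variables `v`, one
for each attribute of `R`. -/
inductive ColTm (D : DataSchema) (T : D.Ty → Type) (R : D.Repo) : D.Ty → Type
  | old {s : D.Ty} (t : T s) : ColTm D T R s
  | col (k : Fin (D.repoArity R)) : ColTm D T R (D.repoAttr R k)

/-- A filter: a repo-free guard, i.e. a disjunction of conjunctions of literals none of which is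
over a repository relation. -/
abbrev Filter (D : DataSchema) (T : D.Ty → Type) (R : D.Repo) : Type :=
  List (List (Lit (BaseAtom D (ColTm D T R))))

/-- The branches of a conditional update: `R(u')` or a nested if-then-else. -/
inductive Branch (D : DataSchema) (T : D.Ty → Type) (R : D.Repo) : Type
  | row (u : (k : Fin (D.repoArity R)) → ColTm D T R (D.repoAttr R k))
  | ite (ψ : Filter D T R) (η₁ η₂ : Branch D T R)

/-- `SET x₁ = v₁, …, xₙ = vₙ` for distinct case variables different from `self`, presented as a
partial map on the case variables. -/
structure SetPart (D : DataSchema) (T : D.Ty → Type) where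
  val : (x : D.CVar) → Option (T (D.cvSort x))
  self_none : val D.self = none

/-- Effect rules.  The `AND SET` part may be empty; `set` is a pure Set rule. -/
inductive Effect (D : DataSchema) (T : D.Ty → Type) : Type
  | set (σ : SetPart D T)
  | insertSet (R : D.Repo) (u : (k : Fin (D.repoArity R)) → T (D.repoAttr R k)) (σ : SetPart D T)
  | deleteSet (R : D.Repo) (u : (k : Fin (D.repoArity R)) → T (D.repoAttr R k)) (σ : SetPart D T)
  | condUpdate (R : D.Repo) (ψ : Filter D T R) (η₁ η₂ : Branch D T R)

section Functoriality

variable {D : DataSchema} {T T' : D.Ty → Type}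

/-! Replacing the terms of a query or an update. -/

def BaseAtom.map (f : (s : D.Ty) → T s → T' s) : BaseAtom D T → BaseAtom D T'
  | .eq s t u => .eq s (f s t) (f s u)
  | .cat R t₀ t => .cat R (f _ t₀) (fun k => f _ (t k))

def Atom.map (f : (s : D.Ty) → T s → T' s) : Atom D T → Atom D T'
  | .base A => .base (A.map f)
  | .repo R t => .repo R (fun k => f _ (t k))

def Lit.map {A B : Type} (f : A → B) (L : Lit A) : Lit B := ⟨L.pos, f L.atom⟩

def Cube.map (f : (s : D.Ty) → T s → T' s) (Q : Cube D T) : Cube D T' :=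
  List.map (Lit.map (Atom.map f)) Q

def Cond.map (f : (s : D.Ty) → T s → T' s) : Cond D T → Cond D T'
  | .eq s t u => .eq s (f s t) (f s u)
  | .neg φ => .neg (φ.map f)
  | .and φ ψ => .and (φ.map f) (ψ.map f)

def ColTm.map {R : D.Repo} (f : (s : D.Ty) → T s → T' s) :
    (s : D.Ty) → ColTm D T R s → ColTm D T' R s
  | _, .old t => .old (f _ t)
  | _, .col k => .col k

def Filter.map {R : D.Repo} (f : (s : D.Ty) → T s → T' s) (ψ : Filter D T R) : Filter D T' R :=
  List.map (List.map (Lit.map (BaseAtom.map (ColTm.map f)))) ψ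

def Branch.map {R : D.Repo} (f : (s : D.Ty) → T s → T' s) : Branch D T R → Branch D T' R
  | .row u => .row (fun k => ColTm.map f _ (u k))
  | .ite ψ η₁ η₂ => .ite (Filter.map f ψ) (η₁.map f) (η₂.map f)

def SetPart.map (f : (s : D.Ty) → T s → T' s) (σ : SetPart D T) : SetPart D T' where
  val x := (σ.val x).map (f _)
  self_none := by simp [σ.self_none]

def Effect.map (f : (s : D.Ty) → T s → T' s) : Effect D T → Effect D T'
  | .set σ => .set (σ.map f)
  | .insertSet R u σ => .insertSet R (fun k => f _ (u k)) (σ.map f)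
  | .deleteSet R u σ => .deleteSet R (fun k => f _ (u k)) (σ.map f)
  | .condUpdate R ψ η₁ η₂ => .condUpdate R (Filter.map f ψ) (η₁.map f) (η₂.map f)

/-! The normal variables occurring in a query or an update, given those of terms. -/

variable (nv : (s : D.Ty) → T s → List (NVar D))

def BaseAtom.nvars : BaseAtom D T → List (NVar D)
  | .eq s t u => nv s t ++ nv s u
  | .cat _ t₀ t => nv _ t₀ ++ (List.ofFn fun k => nv _ (t k)).flatten

def Atom.nvars : Atom D T → List (NVar D)
  | .base A => A.nvars nv
  | .repo _ t => (List.ofFn fun k => nv _ (t k)).flatten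

def Cube.nvars (Q : Cube D T) : List (NVar D) := List.flatMap (fun L => L.atom.nvars nv) Q

def Cond.nvars : Cond D T → List (NVar D)
  | .eq s t u => nv s t ++ nv s u
  | .neg φ => φ.nvars
  | .and φ ψ => φ.nvars ++ ψ.nvars

def ColTm.nvars {R : D.Repo} : (s : D.Ty) → ColTm D T R s → List (NVar D)
  | _, .old t => nv _ t
  | _, .col _ => []

def Filter.nvars {R : D.Repo} (ψ : Filter D T R) : List (NVar D) :=
  List.flatMap (fun Q => List.flatMap (fun L => L.atom.nvars (ColTm.nvars nv)) Q) ψ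

/-- The variables of the rows `R(u')` of a branch. -/
def Branch.rowNvars {R : D.Repo} : Branch D T R → List (NVar D)
  | .row u => (List.ofFn fun k => ColTm.nvars nv _ (u k)).flatten
  | .ite _ η₁ η₂ => η₁.rowNvars ++ η₂.rowNvars

/-- The variables of the filters of a branch. -/
def Branch.filterNvars {R : D.Repo} : Branch D T R → List (NVar D)
  | .row _ => []
  | .ite ψ η₁ η₂ => Filter.nvars nv ψ ++ η₁.filterNvars ++ η₂.filterNvars

noncomputable def SetPart.nvars (σ : SetPart D T) : List (NVar D) :=
  (Finset.univ : Finset D.CVar).toList.flatMap fun x => ((σ.val x).map (nv _)).getD []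

/-- The variables of the tuples and values written by an effect. -/
noncomputable def Effect.valueNvars : Effect D T → List (NVar D)
  | .set σ => σ.nvars nv
  | .insertSet _ u σ => (List.ofFn fun k => nv _ (u k)).flatten ++ σ.nvars nv
  | .deleteSet _ u σ => (List.ofFn fun k => nv _ (u k)).flatten ++ σ.nvars nv
  | .condUpdate _ _ η₁ η₂ => η₁.rowNvars nv ++ η₂.rowNvars nv

/-- The variables of the filters of an effect. -/
def Effect.filterNvars : Effect D T → List (NVar D)
  | .set _ => []
  | .insertSet _ _ _ => []
  | .deleteSet _ _ _ => []
  | .condUpdate _ ψ η₁ η₂ => Filter.nvars nv ψ ++ η₁.filterNvars nv ++ η₂.filterNvars nv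

end Functoriality

/-- A guard `q(x) ← ⋁ᵢ Qᵢ` with answer variables `x`, all of which occur in every `Qᵢ`. -/
structure Guard (D : DataSchema) where
  head : List (NVar D)
  disjuncts : List (Cube D (DTm D))
  head_subset : ∀ Q ∈ disjuncts, ∀ x ∈ head, x ∈ Cube.nvars (fun _ => DTm.nvars) Q

/-- An update specification: a precondition and an effect rule whose values are answer variables
of the precondition, case variables or constants. -/
structure UpdateSpec (D : DataSchema) where
  pre : Guard D
  eff : Effect D (DTm D)
  eff_head : ∀ x ∈ eff.valueNvars (fun _ => DTm.nvars), x ∈ pre.head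

/-- The block types with the attributes that matter for the translation; the nested blocks are
given by their names. -/
inductive Shape (D : DataSchema) (Blk : Type) : Type
  | empty
  | task (α : UpdateSpec D)
  /-- the effect of a nonatomic task only sets case variables -/
  | nonatomicTask (α : UpdateSpec D) (h : ∃ σ, α.eff = .set σ)
  | event (α : UpdateSpec D)
  /-- start event, nested block, end event -/
  | proc (es B₁ et : Blk)
  | subproc (B₁ : Blk)
  | seq (B₁ B₂ : Blk)
  /-- iterated sequence of more than two blocks -/
  | nseq (Bs : List Blk) (h : 2 < Bs.length)
  | par (B₁ B₂ : Blk)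
  | or (φ₁ φ₂ : Cond D (DTm D)) (B₁ B₂ : Blk)
  | choice (φ : Cond D (DTm D)) (B₁ B₂ : Blk)
  | defChoice (B₁ B₂ : Blk)
  | loop (φ : Cond D (DTm D)) (B₁ B₂ : Blk)
  /-- block with error; `H` is the block with the boundary event that catches the error -/
  | err (φ : Cond D (DTm D)) (B₁ : Blk) (H : Blk)
  /-- event-based fork between the event `E₁` and the error event `E₂` caught at `H` -/
  | errEvent (E₁ E₂ : Blk) (H : Blk)
  | backExcp (A B₁ : Blk)
  | forExcp (A B₁ B₂ : Blk)
  | nonInterr (A B₁ B₂ : Blk)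

/-- The directly nested blocks. -/
def Shape.children {D : DataSchema} {Blk : Type} : Shape D Blk → List Blk
  | .empty => []
  | .task _ => []
  | .nonatomicTask _ _ => []
  | .event _ => []
  | .proc es B₁ et => [es, B₁, et]
  | .subproc B₁ => [B₁]
  | .seq B₁ B₂ => [B₁, B₂]
  | .nseq Bs _ => Bs
  | .par B₁ B₂ => [B₁, B₂]
  | .or _ _ B₁ B₂ => [B₁, B₂]
  | .choice _ B₁ B₂ => [B₁, B₂]
  | .defChoice B₁ B₂ => [B₁, B₂]
  | .loop _ B₁ B₂ => [B₁, B₂]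
  | .err _ B₁ _ => [B₁]
  | .errEvent E₁ E₂ _ => [E₁, E₂]
  | .backExcp A B₁ => [A, B₁]
  | .forExcp A B₁ B₂ => [A, B₁, B₂]
  | .nonInterr A B₁ B₂ => [A, B₁, B₂]

/-- A data-aware BPMN model: a data schema and a root process block, which is a finite tree of
named blocks.  An error is caught at an enclosing block that carries the boundary event of an
(interrupting) exception handling block. -/
structure DAB extends DataSchema where
  Blk : Type
  [blkFintype : Fintype Blk]
  shape : Blk → Shape toDataSchema Blk
  root : Blk
  root_proc : ∃ es B₁ et, shape root = .proc es B₁ et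
  reachable : ∀ B, Relation.ReflTransGen (fun P C => C ∈ (shape P).children) root B
  children_nodup : ∀ B, (shape B).children.Nodup
  parent_unique : ∀ P Q C, C ∈ (shape P).children → C ∈ (shape Q).children → P = Q
  acyclic : ∀ B, ¬ Relation.TransGen (fun P C => C ∈ (shape P).children) B B
  proc_events : ∀ B es B₁ et, shape B = .proc es B₁ et →
    (∃ α, shape es = .event α) ∧ ∃ α, shape et = .event α
  subproc_proc : ∀ B B₁, shape B = .subproc B₁ → ∃ es B₂ et, shape B₁ = .proc es B₂ et
  errEvent_events : ∀ B E₁ E₂ H, shape B = .errEvent E₁ E₂ H →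
    (∃ α, shape E₁ = .event α) ∧ ∃ α, shape E₂ = .event α
  error_caught : ∀ B H, ((∃ φ B₁, shape B = .err φ B₁ H) ∨ ∃ E₁ E₂, shape B = .errEvent E₁ E₂ H) →
    Relation.ReflTransGen (fun P C => C ∈ (shape P).children) H B ∧
    ∃ E, (∃ B₁, shape E = .backExcp H B₁) ∨ ∃ B₁ B₂, shape E = .forExcp H B₁ B₂

attribute [instance] DAB.blkFintype

open Classical in
/-- All the (proper) sub-blocks of a block. -/
noncomputable def DAB.subBlocks (M : DAB) (A : M.Blk) : List M.Blk :=
  ((Finset.univ : Finset M.Blk).filter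
    (Relation.TransGen (fun P C => C ∈ (M.shape P).children) A)).toList

/-! ## Part 3: the rule-based transitions of the blocks -/

/-- Lifecycle states.  There is one label `error` for each block with a boundary event. -/
inductive Label (Blk : Type) : Type
  | idle
  | enabled
  | active
  | completed
  | waiting
  | waiting1
  | waiting2
  | error (A : Blk)

/-- A rule `if Guard then Update` for the process instance `I`.  The guard is the conjunction of an
extended cube, of extended conditions, of equations `lifecycleStateB[I] = l`, and of equations
`errorA = b`; the update consists of an extended update (or of no update of the data), and of the
assignments `lifecycleStateB'[I] = l`, `errorB'[I] = b` and `errorA' = b`. -/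
structure Rule (M : DAB) where
  I : ℕ
  cube : Cube M.toDataSchema (ETm M.toDataSchema) := []
  conds : List (Cond M.toDataSchema (ETm M.toDataSchema)) := []
  life : List (M.Blk × Label M.Blk) := []
  flag : List (M.Blk × Bool) := []
  eff : Option (Effect M.toDataSchema (ETm M.toDataSchema)) := none
  lifeUpd : List (M.Blk × Label M.Blk) := []
  instFlagUpd : List (M.Blk × Bool) := []
  flagUpd : List (M.Blk × Bool) := []

section Rules

variable {M : DAB}

/-- Extended versions `φ_ext(I)` of cubes, conditions and effects. -/
def extCube (I : ℕ) (Q : Cube M.toDataSchema (DTm M.toDataSchema)) :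
    Cube M.toDataSchema (ETm M.toDataSchema) := Cube.map (DTm.ext I) Q

def extCond (I : ℕ) (φ : Cond M.toDataSchema (DTm M.toDataSchema)) :
    Cond M.toDataSchema (ETm M.toDataSchema) := φ.map (DTm.ext I)

def extEff (I : ℕ) (E : Effect M.toDataSchema (DTm M.toDataSchema)) :
    Effect M.toDataSchema (ETm M.toDataSchema) := E.map (DTm.ext I)

end Rules

open Label in
/-- `Produces M B r`: the translation of the block `B` of `M` produces the rule `r`.  A task whose
precondition is a disjunction of cubes yields one rule for each of the cubes. -/
inductive Produces (M : DAB) : M.Blk → Rule M → Prop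
  -- tasks and events
  | task {B α Q} (I : ℕ) (hB : M.shape B = .task α) (hQ : Q ∈ α.pre.disjuncts) :
      Produces M B { I := I, life := [(B, enabled)], cube := extCube I Q,
                     lifeUpd := [(B, completed)], eff := some (extEff I α.eff) }
  | nonatomicTask₁ {B α h Q} (I : ℕ) (hB : M.shape B = .nonatomicTask α h)
      (hQ : Q ∈ α.pre.disjuncts) :
      Produces M B { I := I, life := [(B, enabled)], cube := extCube I Q,
                     lifeUpd := [(B, active)] }
  | nonatomicTask₂ {B α h} (I : ℕ) (hB : M.shape B = .nonatomicTask α h) :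
      Produces M B { I := I, life := [(B, active)],
                     lifeUpd := [(B, completed)], eff := some (extEff I α.eff) }
  | event {B α} (I : ℕ) (hB : M.shape B = .event α) :
      Produces M B { I := I, life := [(B, enabled)],
                     lifeUpd := [(B, completed)], eff := some (extEff I α.eff) }
  -- sequence flow
  | seq₁ {B B₁ B₂} (I : ℕ) (hB : M.shape B = .seq B₁ B₂) :
      Produces M B { I := I, life := [(B, enabled)],
                     lifeUpd := [(B₁, enabled), (B, waiting)] }
  | seq₂ {B B₁ B₂} (I : ℕ) (hB : M.shape B = .seq B₁ B₂) :
      Produces M B { I := I, life := [(B₁, completed)],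
                     lifeUpd := [(B₁, idle), (B₂, enabled)] }
  | seq₃ {B B₁ B₂} (I : ℕ) (hB : M.shape B = .seq B₁ B₂) :
      Produces M B { I := I, life := [(B₂, completed)],
                     lifeUpd := [(B₂, idle), (B, completed)] }
  -- iterated sequence flow
  | nseqFirst {B Bs h B₁} (I : ℕ) (hB : M.shape B = .nseq Bs h) (h₁ : Bs.head? = some B₁) :
      Produces M B { I := I, life := [(B, enabled)],
                     lifeUpd := [(B₁, enabled), (B, waiting)] }
  | nseqNext {B Bs h k C C'} (I : ℕ) (hB : M.shape B = .nseq Bs h)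
      (hC : Bs[k]? = some C) (hC' : Bs[k + 1]? = some C') :
      Produces M B { I := I, life := [(C, completed)],
                     lifeUpd := [(C, idle), (C', enabled)] }
  | nseqLast {B Bs h Bn} (I : ℕ) (hB : M.shape B = .nseq Bs h) (hn : Bs.getLast? = some Bn) :
      Produces M B { I := I, life := [(Bn, completed)],
                     lifeUpd := [(Bn, idle), (B, completed)] }
  -- parallel block
  | par₁ {B B₁ B₂} (I : ℕ) (hB : M.shape B = .par B₁ B₂) :
      Produces M B { I := I, life := [(B, enabled)],
                     lifeUpd := [(B₁, enabled), (B₂, enabled), (B, waiting)] }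
  | par₂ {B B₁ B₂} (I : ℕ) (hB : M.shape B = .par B₁ B₂) :
      Produces M B { I := I, life := [(B₁, completed), (B₂, completed)],
                     lifeUpd := [(B₁, idle), (B₂, idle), (B, completed)] }
  -- conditional inclusive block
  | or₁ {B φ₁ φ₂ B₁ B₂} (I : ℕ) (hB : M.shape B = .or φ₁ φ₂ B₁ B₂) :
      Produces M B { I := I, life := [(B, enabled)],
                     conds := [.and (extCond I φ₁) (.neg (extCond I φ₂))],
                     lifeUpd := [(B₁, enabled), (B, waiting1)] }
  | or₂ {B φ₁ φ₂ B₁ B₂} (I : ℕ) (hB : M.shape B = .or φ₁ φ₂ B₁ B₂) :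
      Produces M B { I := I, life := [(B, enabled)],
                     conds := [.and (extCond I φ₂) (.neg (extCond I φ₁))],
                     lifeUpd := [(B₂, enabled), (B, waiting1)] }
  | or₃ {B φ₁ φ₂ B₁ B₂} (I : ℕ) (hB : M.shape B = .or φ₁ φ₂ B₁ B₂) :
      Produces M B { I := I, life := [(B, enabled)],
                     conds := [.and (extCond I φ₁) (extCond I φ₂)],
                     lifeUpd := [(B₁, enabled), (B₂, enabled), (B, waiting2)] }
  | or₄ {B φ₁ φ₂ B₁ B₂} (I : ℕ) (hB : M.shape B = .or φ₁ φ₂ B₁ B₂) :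
      Produces M B { I := I, life := [(B₁, completed), (B, waiting1)],
                     lifeUpd := [(B₁, idle), (B, completed)] }
  | or₅ {B φ₁ φ₂ B₁ B₂} (I : ℕ) (hB : M.shape B = .or φ₁ φ₂ B₁ B₂) :
      Produces M B { I := I, life := [(B, waiting1), (B₂, completed)],
                     lifeUpd := [(B₂, idle), (B, completed)] }
  | or₆ {B φ₁ φ₂ B₁ B₂} (I : ℕ) (hB : M.shape B = .or φ₁ φ₂ B₁ B₂) :
      Produces M B { I := I, life := [(B₁, completed), (B₂, completed)],
                     lifeUpd := [(B₁, idle), (B₂, idle), (B, completed)] }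
  -- conditional exclusive block
  | choice₁ {B φ B₁ B₂} (I : ℕ) (hB : M.shape B = .choice φ B₁ B₂) :
      Produces M B { I := I, life := [(B, enabled)], conds := [extCond I φ],
                     lifeUpd := [(B₁, enabled), (B, waiting)] }
  | choice₂ {B φ B₁ B₂} (I : ℕ) (hB : M.shape B = .choice φ B₁ B₂) :
      Produces M B { I := I, life := [(B, enabled)], conds := [.neg (extCond I φ)],
                     lifeUpd := [(B₂, enabled), (B, waiting)] }
  | choice₃ {B φ B₁ B₂} (I : ℕ) (hB : M.shape B = .choice φ B₁ B₂) :
      Produces M B { I := I, life := [(B₁, completed)],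
                     lifeUpd := [(B₁, idle), (B, completed)] }
  | choice₄ {B φ B₁ B₂} (I : ℕ) (hB : M.shape B = .choice φ B₁ B₂) :
      Produces M B { I := I, life := [(B₂, completed)],
                     lifeUpd := [(B₂, idle), (B, completed)] }
  -- deferred choice
  | defChoice₁ {B B₁ B₂} (I : ℕ) (hB : M.shape B = .defChoice B₁ B₂) :
      Produces M B { I := I, life := [(B, enabled)],
                     lifeUpd := [(B₁, enabled), (B, waiting)] }
  | defChoice₂ {B B₁ B₂} (I : ℕ) (hB : M.shape B = .defChoice B₁ B₂) :
      Produces M B { I := I, life := [(B, enabled)],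
                     lifeUpd := [(B₂, enabled), (B, waiting)] }
  | defChoice₃ {B B₁ B₂} (I : ℕ) (hB : M.shape B = .defChoice B₁ B₂) :
      Produces M B { I := I, life := [(B₁, completed)],
                     lifeUpd := [(B₁, idle), (B, completed)] }
  | defChoice₄ {B B₁ B₂} (I : ℕ) (hB : M.shape B = .defChoice B₁ B₂) :
      Produces M B { I := I, life := [(B₂, completed)],
                     lifeUpd := [(B₂, idle), (B, completed)] }
  -- loop
  | loop₁ {B φ B₁ B₂} (I : ℕ) (hB : M.shape B = .loop φ B₁ B₂) :
      Produces M B { I := I, life := [(B, enabled)],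
                     lifeUpd := [(B₁, enabled), (B, waiting)] }
  | loop₂ {B φ B₁ B₂} (I : ℕ) (hB : M.shape B = .loop φ B₁ B₂) :
      Produces M B { I := I, life := [(B₁, completed)], conds := [extCond I φ],
                     lifeUpd := [(B₁, idle), (B₂, enabled)] }
  | loop₃ {B φ B₁ B₂} (I : ℕ) (hB : M.shape B = .loop φ B₁ B₂) :
      Produces M B { I := I, life := [(B₂, completed)],
                     lifeUpd := [(B₁, enabled), (B₂, idle)] }
  | loop₄ {B φ B₁ B₂} (I : ℕ) (hB : M.shape B = .loop φ B₁ B₂) :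
      Produces M B { I := I, life := [(B₁, completed)], conds := [.neg (extCond I φ)],
                     lifeUpd := [(B₁, idle), (B, completed)] }
  -- process and subprocess blocks
  | proc₁ {B es B₁ et} (I : ℕ) (hB : M.shape B = .proc es B₁ et) :
      Produces M B { I := I, life := [(B, enabled)],
                     lifeUpd := [(B₁, enabled), (B, waiting)] }
  | proc₂ {B es B₁ et} (I : ℕ) (hB : M.shape B = .proc es B₁ et) :
      Produces M B { I := I, life := [(B₁, completed)],
                     lifeUpd := [(B₁, idle), (B, completed)] }
  | subproc₁ {B B₁} (I : ℕ) (hB : M.shape B = .subproc B₁) :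
      Produces M B { I := I, life := [(B, enabled)],
                     lifeUpd := [(B₁, enabled), (B, waiting)] }
  | subproc₂ {B B₁} (I : ℕ) (hB : M.shape B = .subproc B₁) :
      Produces M B { I := I, life := [(B₁, completed)],
                     lifeUpd := [(B₁, idle), (B, completed)] }
  -- block with error
  | err₁ {B φ B₁ H} (I : ℕ) (hB : M.shape B = .err φ B₁ H) :
      Produces M B { I := I, life := [(B, enabled)],
                     lifeUpd := [(B₁, enabled), (B, waiting)] }
  | err₂ {B φ B₁ H} (I : ℕ) (hB : M.shape B = .err φ B₁ H) :
      Produces M B { I := I, life := [(B₁, completed)], conds := [extCond I φ],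
                     lifeUpd := [(B₁, idle), (B, completed)] }
  | err₃ {B φ B₁ H} (I : ℕ) (hB : M.shape B = .err φ B₁ H) :
      Produces M B { I := I, life := [(B₁, completed)], conds := [.neg (extCond I φ)],
                     lifeUpd := (B₁, idle) :: (M.subBlocks H).map (·, idle) ++ [(H, error H)] }
  | err₃alt {B φ B₁ H} (I : ℕ) (hB : M.shape B = .err φ B₁ H) :
      Produces M B { I := I, life := [(B₁, completed)], conds := [.neg (extCond I φ)],
                     lifeUpd := (B₁, idle) :: (M.subBlocks H).map (·, idle),
                     instFlagUpd := [(H, true)] }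
  -- either error or event
  | errEvent₁ {B E₁ E₂ H α} (I : ℕ) (hB : M.shape B = .errEvent E₁ E₂ H)
      (hE : M.shape E₁ = .event α) :
      Produces M B { I := I, life := [(E₁, enabled)],
                     lifeUpd := [(E₁, completed)], eff := some (extEff I α.eff) }
  | errEvent₂ {B E₁ E₂ H α} (I : ℕ) (hB : M.shape B = .errEvent E₁ E₂ H)
      (hE : M.shape E₂ = .event α) :
      Produces M B { I := I, life := [(E₁, enabled)],
                     lifeUpd := (E₁, idle) :: (M.subBlocks H).map (·, idle) ++ [(H, error H)],
                     eff := some (extEff I α.eff) }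
  -- backward exception handling
  | backExcp₁ {B A B₁} (I : ℕ) (hB : M.shape B = .backExcp A B₁) :
      Produces M B { I := I, life := [(B, enabled)],
                     lifeUpd := [(A, enabled), (B, waiting)] }
  | backExcp₂ {B A B₁} (I : ℕ) (hB : M.shape B = .backExcp A B₁) :
      Produces M B { I := I, life := [(A, completed)],
                     lifeUpd := [(A, idle), (B, completed)] }
  | backExcp₃ {B A B₁} (I : ℕ) (hB : M.shape B = .backExcp A B₁) :
      Produces M B { I := I, life := [(A, error A)],
                     lifeUpd := [(A, idle), (B₁, enabled)] }
  -- forward exception handling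
  | forExcp₁ {B A B₁ B₂} (I : ℕ) (hB : M.shape B = .forExcp A B₁ B₂) :
      Produces M B { I := I, life := [(B, enabled)],
                     lifeUpd := [(A, enabled), (B, waiting)] }
  | forExcp₂ {B A B₁ B₂} (I : ℕ) (hB : M.shape B = .forExcp A B₁ B₂) :
      Produces M B { I := I, life := [(A, completed)],
                     lifeUpd := [(A, idle), (B₁, enabled)] }
  | forExcp₃ {B A B₁ B₂} (I : ℕ) (hB : M.shape B = .forExcp A B₁ B₂) :
      Produces M B { I := I, life := [(B₁, completed)],
                     lifeUpd := [(B₁, idle), (B, completed)] }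
  | forExcp₄ {B A B₁ B₂} (I : ℕ) (hB : M.shape B = .forExcp A B₁ B₂) :
      Produces M B { I := I, life := [(A, error A)],
                     lifeUpd := [(A, idle), (B₂, enabled)] }
  | forExcp₅ {B A B₁ B₂} (I : ℕ) (hB : M.shape B = .forExcp A B₁ B₂) :
      Produces M B { I := I, life := [(B₂, completed)],
                     lifeUpd := [(B₂, idle), (B, completed)] }
  -- non-interrupting exception handling
  | nonInterr₁ {B A B₁ B₂} (I : ℕ) (hB : M.shape B = .nonInterr A B₁ B₂) :
      Produces M B { I := I, life := [(B, enabled)],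
                     lifeUpd := [(A, enabled), (B, waiting)] }
  | nonInterr₂ {B A B₁ B₂} (I : ℕ) (hB : M.shape B = .nonInterr A B₁ B₂) :
      Produces M B { I := I, life := [(A, completed)],
                     lifeUpd := [(A, idle), (B₁, enabled)] }
  | nonInterr₃ {B A B₁ B₂} (I : ℕ) (hB : M.shape B = .nonInterr A B₁ B₂) :
      Produces M B { I := I, life := [(B₁, completed)], flag := [(A, false)],
                     lifeUpd := [(B₁, idle), (B, completed)] }
  | nonInterr₄ {B A B₁ B₂} (I : ℕ) (hB : M.shape B = .nonInterr A B₁ B₂) :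
      Produces M B { I := I, flag := [(A, true)],
                     lifeUpd := [(B₂, enabled)], flagUpd := [(A, true)] }
  | nonInterr₅ {B A B₁ B₂} (I : ℕ) (hB : M.shape B = .nonInterr A B₁ B₂) :
      Produces M B { I := I, life := [(B₁, completed), (B₂, completed)],
                     lifeUpd := [(B₁, idle), (B₂, idle), (B, completed)] }
  -- the occurrence of the exception, for each of the three exception handling blocks
  | raise {B A l} (I : ℕ)
      (hB : (∃ B₁, M.shape B = .backExcp A B₁) ∨ (∃ B₁ B₂, M.shape B = .forExcp A B₁ B₂) ∨
        ∃ B₁ B₂, M.shape B = .nonInterr A B₁ B₂)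
      (hl : l = enabled ∨ l = waiting ∨ l = active) :
      Produces M B { I := I, life := [(A, l)],
                     lifeUpd := (A, error A) :: (M.subBlocks A).map (·, idle) }

/-! ## Part 4: the translation into relational artifact systems -/

/-- Basic sorts: the types of the data schema, lifecycle states, truth values. -/
inductive BasicSort (M : DAB) : Type
  | data (s : M.Ty)
  | life
  | bool

/-- Artifact sorts: `PI_index`, and `R_index` for each repository relation `R`. -/
inductive ArtSort (M : DAB) : Type
  | pi
  | repo (R : M.Repo)

/-- Artifact components: one for each case variable, one control component `lifecycleStateB` (and
one Boolean component `errorB`) for each block, and one for each attribute of each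
repository relation. -/
inductive Component (M : DAB) : Type
  | case (x : M.CVar)
  | life (B : M.Blk)
  | error (B : M.Blk)
  | repo (R : M.Repo) (k : Fin (M.repoArity R))

/-- The constants of a basic sort: the objects of the domain; for the control sorts the labels
and the truth values, with `none` as the undefined value. -/
def BasicSort.Const {M : DAB} : BasicSort M → Type
  | .data s => M.Dom s
  | .life => Option (Label M.Blk)
  | .bool => Option Bool

def BasicSort.undef {M : DAB} : (s : BasicSort M) → s.Const
  | .data s => M.undef s
  | .life => (none : Option (Label M.Blk))
  | .bool => (none : Option Bool)

/-- The signature of the translated system.  The function symbols are the `f_{R,A}`, one for each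
catalog relation `R` and non-key attribute `A`; the artifact variables are the Boolean variables
`errorA`. -/
abbrev DAB.sig (M : DAB) : RAS.Signature where
  Basic := BasicSort M
  Art := ArtSort M
  Const := BasicSort.Const
  undef := BasicSort.undef
  Fn := (R : M.Cat) × Fin (M.catArity R)
  fnSrc f := .data (.inr (M.catKey f.1))
  fnTgt f := .data (M.catAttr f.1 f.2)
  AVar := M.Blk
  avSort _ := .inl .bool
  Comp := Component M
  compSrc
    | .case _ => .pi
    | .life _ => .pi
    | .error _ => .pi
    | .repo R _ => .repo R
  compTgt
    | .case x => .data (M.cvSort x)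
    | .life _ => .life
    | .error _ => .bool
    | .repo R k => .data (M.repoAttr R k)

/-- Names of individual variables: the variable bound by `λ`, the index `i` of the process
instance, `e_ins`, `e_del`, the fresh `e` of the `k`-th literal of the guard, and the normal
variables of the process. -/
inductive Nm : Type
  | lam
  | idx
  | ins
  | del
  | fresh (k : ℕ)
  | usr (n : ℕ)

/-- The two semantics of insertion. -/
inductive InsertSemantics : Type
  | set
  | multiset

section Translation

variable {M : DAB}

abbrev Tm (M : DAB) (s : BasicSort M) : Type := RAS.Term M.sig Nm (.inl s)
abbrev Fm (M : DAB) : Type := RAS.Formula M.sig Nm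

/-- The index variable `i` of sort `PI_index`. -/
def piVar (n : Nm) : RAS.Term M.sig Nm (.inr .pi) :=
  RAS.Syn.var (S := M.sig) (.inr ArtSort.pi) n

/-- A variable of sort `R_index`. -/
def repoVar (R : M.Repo) (n : Nm) : RAS.Term M.sig Nm (.inr (.repo R)) :=
  RAS.Syn.var (S := M.sig) (.inr (ArtSort.repo R)) n

def readCase (x : M.CVar) (t : RAS.Term M.sig Nm (.inr .pi)) : Tm M (.data (M.cvSort x)) :=
  RAS.Syn.read (S := M.sig) .cur (Component.case x) t

def readLife (B : M.Blk) (t : RAS.Term M.sig Nm (.inr .pi)) : Tm M .life :=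
  RAS.Syn.read (S := M.sig) .cur (Component.life B) t

def readError (B : M.Blk) (t : RAS.Term M.sig Nm (.inr .pi)) : Tm M .bool :=
  RAS.Syn.read (S := M.sig) .cur (Component.error B) t

def readRepo (R : M.Repo) (k : Fin (M.repoArity R)) (t : RAS.Term M.sig Nm (.inr (.repo R))) :
    Tm M (.data (M.repoAttr R k)) :=
  RAS.Syn.read (S := M.sig) .cur (Component.repo R k) t

def constData (s : M.Ty) (d : M.Dom s) : Tm M (.data s) :=
  RAS.Syn.const (S := M.sig) (BasicSort.data s) d

def constLife (l : Label M.Blk) : Tm M .life :=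
  RAS.Syn.const (S := M.sig) BasicSort.life (some l : Option (Label M.Blk))

def constBool (b : Bool) : Tm M .bool :=
  RAS.Syn.const (S := M.sig) BasicSort.bool (some b : Option Bool)

/-- A normal variable `y`. -/
def usrVar (s : M.Ty) (n : ℕ) : Tm M (.data s) :=
  RAS.Syn.var (S := M.sig) (.inl (BasicSort.data s)) (.usr n)

/-- Terms: `v[I]` becomes `a_v[i]`. -/
def trTm : (s : M.Ty) → ETm M.toDataSchema s → Tm M (.data s)
  | _, .var s n => usrVar s n
  | _, .inst x _ => readCase x (piVar .idx)
  | _, .const s d => constData s d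

/-- Terms of a conditional update of `R`: the new variable `v_k` becomes `a_{R_k}[j]`. -/
def trColTm (R : M.Repo) :
    (s : M.Ty) → ColTm M.toDataSchema (ETm M.toDataSchema) R s → Tm M (.data s)
  | _, .old t => trTm _ t
  | _, .col k => readRepo R k (repoVar R .lam)

/-- The tuple equation `a_R[e] = u`. -/
def rowEq (R : M.Repo) (e : Nm) (u : (k : Fin (M.repoArity R)) → Tm M (.data (M.repoAttr R k))) :
    Fm M :=
  RAS.conj (List.ofFn fun k => .eq (readRepo R k (repoVar R e)) (u k))

/-- Equations stay; a catalog atom `R(t₀, …, tₙ)` becomes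
`t₀ ≠ undef ∧ t₁ = f₁(t₀) ∧ … ∧ tₙ = fₙ(t₀)`. -/
def trBaseAtom {T : M.Ty → Type} (tr : (s : M.Ty) → T s → Tm M (.data s)) :
    BaseAtom M.toDataSchema T → Fm M
  | .eq s t u => .eq (tr s t) (tr s u)
  | .cat R t₀ t =>
      .and (.neg (.eq (tr _ t₀) (constData _ (M.undef _))))
        (RAS.conj (List.ofFn fun k =>
          .eq (tr _ (t k)) (RAS.Syn.app (S := M.sig) ⟨R, k⟩ (tr _ t₀))))

/-- A repository atom `R(t₁, …, tₙ)`, in the `m`-th literal of the guard, becomes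
`a_{R₁}[e] = t₁ ∧ … ∧ a_{Rₙ}[e] = tₙ` for a fresh `e`. -/
def trAtom (m : ℕ) : Atom M.toDataSchema (ETm M.toDataSchema) → Fm M
  | .base A => trBaseAtom trTm A
  | .repo R t => rowEq R (.fresh m) (fun k => trTm _ (t k))

/-- Put a negation in front of the translation of a negated atom. -/
def trSign (pos : Bool) (φ : Fm M) : Fm M := if pos then φ else .neg φ

def trCube (Q : Cube M.toDataSchema (ETm M.toDataSchema)) : List (Fm M) :=
  (List.zipIdx Q).map fun p => trSign p.1.pos (trAtom p.2 p.1.atom)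

def trCond : Cond M.toDataSchema (ETm M.toDataSchema) → Fm M
  | .eq s t u => .eq (trTm s t) (trTm s u)
  | .neg φ => .neg (trCond φ)
  | .and φ ψ => .and (trCond φ) (trCond ψ)

def trFilter (R : M.Repo) (ψ : Filter M.toDataSchema (ETm M.toDataSchema) R) : Fm M :=
  RAS.disj (List.map (fun Q => RAS.conj (List.map
    (fun L => trSign L.pos (trBaseAtom (trColTm R) L.atom)) Q)) ψ)

/-- The `k`-th component of the (nested) if-then-else of a conditional update. -/
def trBranch (R : M.Repo) (k : Fin (M.repoArity R)) :
    Branch M.toDataSchema (ETm M.toDataSchema) R → Tm M (.data (M.repoAttr R k))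
  | .row u => trColTm R _ (u k)
  | .ite ψ η₁ η₂ => .ite (trFilter R ψ) (trBranch R k η₁) (trBranch R k η₂)

/-- An update `a' = λ j. G` of an artifact component, given by `G`; the variable `j` has the name
`lam`. -/
abbrev CompUpd (M : DAB) : Type := (a : Component M) × Tm M (M.sig.compTgt a)

/-- The condition `j = i`. -/
def atI : Fm M := .eq (piVar .lam) (piVar .idx)

/-- `SET` part: `a_x' = λ j. (if j = i then v else a_x[j])`. -/
noncomputable def trSet (σ : SetPart M.toDataSchema (ETm M.toDataSchema)) : List (CompUpd M) :=
  (Finset.univ : Finset M.CVar).toList.filterMap fun x =>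
    (σ.val x).map fun v =>
      ⟨.case x, (.ite atI (trTm _ v) (readCase x (piVar .lam)) : Tm M (.data (M.cvSort x)))⟩

/-- An update of all the components of `R`. -/
def rowUpd (R : M.Repo)
    (G : (k : Fin (M.repoArity R)) → Tm M (.data (M.repoAttr R k))) : List (CompUpd M) :=
  List.ofFn fun k => ⟨.repo R k, G k⟩

/-- The component updates that replace an effect. -/
noncomputable def trEffect (sem : M.Repo → InsertSemantics) :
    Effect M.toDataSchema (ETm M.toDataSchema) → List (CompUpd M)
  | .set σ => trSet σ
  | .insertSet R u σ =>
      rowUpd R (fun k =>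
        .ite (.eq (repoVar R .lam) (repoVar R .ins)) (trTm _ (u k))
          (match sem R with
            | .set => .ite (rowEq R .lam fun m => trTm _ (u m)) (constData _ (M.undef _))
                (readRepo R k (repoVar R .lam))
            | .multiset => readRepo R k (repoVar R .lam)))
      ++ trSet σ
  | .deleteSet R _ σ =>
      rowUpd R (fun k =>
        .ite (.eq (repoVar R .lam) (repoVar R .del)) (constData _ (M.undef _))
          (readRepo R k (repoVar R .lam)))
      ++ trSet σ
  | .condUpdate R ψ η₁ η₂ => rowUpd R (fun k => trBranch R k (.ite ψ η₁ η₂))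

/-- The formulae that an effect adds to the guard. -/
def effectGuard : Effect M.toDataSchema (ETm M.toDataSchema) → List (Fm M)
  | .set _ => []
  | .insertSet R _ _ => [rowEq R .ins fun _ => constData _ (M.undef _)]
  | .deleteSet R u _ => [rowEq R .del fun k => trTm _ (u k)]
  | .condUpdate _ _ _ _ => []

/-- All the artifact components. -/
noncomputable def allComponents (M : DAB) : List (Component M) :=
  (Finset.univ : Finset M.CVar).toList.map .case ++
  (Finset.univ : Finset M.Blk).toList.map .life ++
  (Finset.univ : Finset M.Blk).toList.map .error ++
  (Finset.univ : Finset M.Repo).toList.flatMap fun R => List.ofFn fun k => .repo R k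

/-- `a[j]` for an arbitrary component `a`. -/
def readSelf (a : Component M) : Tm M (M.sig.compTgt a) :=
  RAS.Syn.read (S := M.sig) .cur a (.var _ Nm.lam)

namespace Rule

variable (r : Rule M) (sem : M.Repo → InsertSemantics)

/-- The rewritten guard `G`. -/
def guardFormula : Fm M :=
  RAS.conj (
    r.life.map (fun p => .eq (readLife p.1 (piVar .idx)) (constLife p.2)) ++
    r.flag.map (fun p => .eq (RAS.Syn.avar (S := M.sig) .cur p.1) (constBool p.2)) ++
    trCube r.cube ++
    r.conds.map trCond ++
    (r.eff.map effectGuard).getD [])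

open Classical in
/-- The updates of artifact components that the rule mentions; repeated ones are kept once. -/
noncomputable def mentioned : List (CompUpd M) :=
  r.lifeUpd.dedup.map (fun p =>
    ⟨.life p.1, (.ite atI (constLife p.2) (readLife p.1 (piVar .lam)) : Tm M .life)⟩) ++
  r.instFlagUpd.dedup.map (fun p =>
    ⟨.error p.1, (.ite atI (constBool p.2) (readError p.1 (piVar .lam)) : Tm M .bool)⟩) ++
  (r.eff.map (trEffect sem)).getD []

open Classical in
/-- All the updates of artifact components: those not mentioned keep their values. -/
noncomputable def compUpdates : List (CompUpd M) :=
  r.mentioned sem ++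
  ((allComponents M).filter fun a => a ∉ (r.mentioned sem).map Sigma.fst).map
    fun a => ⟨a, readSelf a⟩

open Classical in
/-- All the updates of artifact variables. -/
noncomputable def avarUpdates : List (M.Blk × Tm M .bool) :=
  r.flagUpd.dedup.map (fun p => (p.1, constBool p.2)) ++
  ((Finset.univ : Finset M.Blk).toList.filter fun x => x ∉ r.flagUpd.map Prod.fst).map
    fun x => (x, RAS.Syn.avar (S := M.sig) .cur x)

/-- The rewritten update `U`. -/
noncomputable def updateFormula : Fm M :=
  .and
    (RAS.conj (r.avarUpdates.map fun f => RAS.avarUpdate (S := M.sig) f.1 f.2))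
    (RAS.conj ((r.compUpdates sem).map fun g => RAS.compUpdate (S := M.sig) g.1 .lam g.2))

/-- The variables `e_ins`, each with its relation. -/
def insVars : List (M.Repo × Nm) :=
  match r.eff with
  | some (.insertSet R _ _) => [(R, .ins)]
  | _ => []

/-- The variables `e_del`. -/
def delVars : List (M.Repo × Nm) :=
  match r.eff with
  | some (.deleteSet R _ _) => [(R, .del)]
  | _ => []

/-- The fresh variables `e`, one for each repository atom of the guard. -/
def freshVars : List (M.Repo × Nm) :=
  (List.zipIdx r.cube).filterMap fun p =>
    match p.1.atom with
    | .repo R _ => some (R, .fresh p.2)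
    | .base _ => none

open Classical in
/-- The normal variables `y` that occur in the guard or in the update. -/
noncomputable def usrVars : List (NVar M.toDataSchema) :=
  (Cube.nvars (fun _ => ETm.nvars) r.cube ++
    r.conds.flatMap (Cond.nvars fun _ => ETm.nvars) ++
    (r.eff.map fun E => E.valueNvars (fun _ => ETm.nvars) ++ E.filterNvars fun _ => ETm.nvars).getD
      []).dedup

end Rule

/-- The formula `∃ e_ins ∃ e_del ∃ e ∃ i ∃ y (G ∧ U)`, where `e_ins`, `e_del`, `e` are variables of
sorts `R_index`, `i` is a variable of sort `PI_index`, and the `y` are variables of basic sorts. -/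
def ruleFormula (eIns eDel e : List (M.Repo × Nm)) (i : Nm) (y : List (M.Ty × Nm)) (G U : Fm M) :
    Fm M :=
  RAS.exs (eIns.map fun v => (.inr (.repo v.1), v.2)) <|
  RAS.exs (eDel.map fun v => (.inr (.repo v.1), v.2)) <|
  RAS.exs (e.map fun v => (.inr (.repo v.1), v.2)) <|
  RAS.Syn.ex (S := M.sig) (.inr .pi) i <|
  RAS.exs (y.map fun v => (.inl (.data v.1), v.2)) <|
  .and G U

/-- The formula obtained from a rule by the rewriting. -/
noncomputable def Rule.toFormula (r : Rule M) (sem : M.Repo → InsertSemantics) : Fm M :=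
  ruleFormula r.insVars r.delVars r.freshVars .idx (r.usrVars.map fun v => (v.1, .usr v.2))
    r.guardFormula (r.updateFormula sem)

/-! Finally, the quantifiers `∃ y` are eliminated for those `y` that have a definition `a_R[e] = y`
in the guard. -/

/-- `a_{R_k}[e] = y` is a conjunct of the guard of `r`, and `t` is its left-hand side. -/
def Rule.IsDefinition (r : Rule M) (y : NVar M.toDataSchema) (t : Tm M (.data y.1)) : Prop :=
  (∃ (R : M.Repo) (k : Fin (M.repoArity R)) (e : Nm),
    (⟨M.repoAttr R k, readRepo R k (repoVar R e)⟩ : (s : M.Ty) × Tm M (.data s)) = ⟨y.1, t⟩) ∧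
  RAS.Syn.eq t (usrVar y.1 y.2) ∈ r.guardFormula.conjuncts

open Classical in
/-- The substitution of `a_R[e]` for the variables `y` defined in this way. -/
noncomputable def Rule.elim (r : Rule M) : (s : M.sig.Srt) → Nm → RAS.Term M.sig Nm s
  | .inl (.data s), .usr n =>
      if h : ∃ t, r.IsDefinition (s, n) t then h.choose else usrVar s n
  | s, n => .var s n

open Classical in
/-- The formula obtained from a rule by the rewriting and the elimination of the `∃ y`. -/
noncomputable def Rule.toReducedFormula (r : Rule M) (sem : M.Repo → InsertSemantics) : Fm M :=
  ruleFormula r.insVars r.delVars r.freshVars .idx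
    ((r.usrVars.filter fun y => ¬ ∃ t, r.IsDefinition y t).map fun v => (v.1, .usr v.2))
    (r.guardFormula.subst r.elim) ((r.updateFormula sem).subst r.elim)

/-- `φ` has the form `∃ e_ins ∃ e_del ∃ e ∃ i ∃ y (G ∧ U)` with a quantifier-free `G`. -/
def HasRuleForm (φ : Fm M) : Prop :=
  ∃ (eIns eDel e : List (M.Repo × Nm)) (i : Nm) (y : List (M.Ty × Nm)) (G U : Fm M),
    G.QuantifierFree ∧ φ = ruleFormula eIns eDel e i y G U

end Translation

end DABModel

namespace RAS

variable {S : Signature} {N : Type}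

/-- A quantifier-free expression without if-then-else, over the individual variables in `V` and the
current artifact setting. -/
structure Syn.Plain {k : Kind S.Srt} (φ : Syn S N k) (V : Set (S.Srt × N)) : Prop where
  quantifierFree : φ.QuantifierFree
  iteFree : φ.IteFree
  isOver : φ.Over V

namespace Syn.Plain

variable {V W : Set (S.Srt × N)}

theorem var {s : S.Srt} {n : N} (h : (s, n) ∈ V) : (Syn.var s n : Term S N s).Plain V :=
  ⟨trivial, trivial, h⟩

theorem const (s : S.Basic) (c : S.Const s) : (Syn.const s c : Term S N (.inl s)).Plain V :=
  ⟨trivial, trivial, trivial⟩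

theorem app (f : S.Fn) {t : Term S N (.inl (S.fnSrc f))} (h : t.Plain V) :
    (Syn.app f t).Plain V :=
  ⟨h.1, h.2, h.3⟩

theorem avar (x : S.AVar) : (Syn.avar .cur x : Term S N (S.avSort x)).Plain V :=
  ⟨trivial, trivial, rfl⟩

theorem read (a : S.Comp) {t : Term S N (.inr (S.compSrc a))} (h : t.Plain V) :
    (Syn.read .cur a t).Plain V :=
  ⟨h.1, h.2, rfl, h.3⟩

theorem eq {s : S.Srt} {t u : Term S N s} (ht : t.Plain V) (hu : u.Plain V) :
    (Syn.eq t u).Plain V :=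
  ⟨⟨ht.1, hu.1⟩, ⟨ht.2, hu.2⟩, ⟨ht.3, hu.3⟩⟩

theorem tru : (Syn.tru : Formula S N).Plain V := ⟨trivial, trivial, trivial⟩

theorem neg {φ : Formula S N} (h : φ.Plain V) : φ.neg.Plain V := ⟨h.1, h.2, h.3⟩

theorem and {φ ψ : Formula S N} (hφ : φ.Plain V) (hψ : ψ.Plain V) : (φ.and ψ).Plain V :=
  ⟨⟨hφ.1, hψ.1⟩, ⟨hφ.2, hψ.2⟩, ⟨hφ.3, hψ.3⟩⟩

theorem or {φ ψ : Formula S N} (hφ : φ.Plain V) (hψ : ψ.Plain V) : (φ.or ψ).Plain V :=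
  (hφ.neg.and hψ.neg).neg

theorem conj {l : List (Formula S N)} (h : ∀ φ ∈ l, φ.Plain V) : (conj l).Plain V := by
  induction l with
  | nil => exact tru
  | cons φ l ih =>
    exact and (h φ List.mem_cons_self) (ih fun ψ hψ => h ψ (List.mem_cons_of_mem _ hψ))

theorem disj {l : List (Formula S N)} (h : ∀ φ ∈ l, φ.Plain V) : (disj l).Plain V := by
  induction l with
  | nil => exact tru.neg
  | cons φ l ih =>
    exact or (h φ List.mem_cons_self) (ih fun ψ hψ => h ψ (List.mem_cons_of_mem _ hψ))

/-- Substitution of plain terms preserves plainness. -/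
theorem subst {k : Kind S.Srt} {φ : Syn S N k} (h : φ.Plain V)
    {σ : (s : S.Srt) → N → Term S N s} (hσ : ∀ s n, (s, n) ∈ V → (σ s n).Plain W) :
    (φ.subst σ).Plain W := by
  obtain ⟨hq, hi, ho⟩ := h
  induction φ with
  | var s n => exact hσ s n ho
  | const s c => exact const s c
  | app f t ih => exact app f (ih hq hi ho)
  | avar p x => cases ho; exact avar x
  | read p a t ih => obtain ⟨rfl, ho⟩ := ho; exact read a (ih hq hi ho)
  | ite c t u => exact hi.elim
  | eq t u iht ihu => exact eq (iht hq.1 hi.1 ho.1) (ihu hq.2 hi.2 ho.2)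
  | tru => exact tru
  | neg φ ih => exact neg (ih hq hi ho)
  | and φ ψ ihφ ihψ => exact and (ihφ hq.1 hi.1 ho.1) (ihψ hq.2 hi.2 ho.2)
  | ex s n φ => exact hq.elim
  | all s n φ => exact hq.elim

theorem of_mem_conjuncts : ∀ {φ ψ : Formula S N}, φ.Plain V → ψ ∈ φ.conjuncts → ψ.Plain V
  | .and φ₁ φ₂, ψ, h, hψ => by
    rw [Syn.conjuncts, List.mem_append] at hψ
    rcases hψ with hψ | hψ
    · exact of_mem_conjuncts ⟨h.1.1, h.2.1, h.3.1⟩ hψ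
    · exact of_mem_conjuncts ⟨h.1.2, h.2.2, h.3.2⟩ hψ
  | .eq t u, ψ, h, hψ => by
    rw [Syn.conjuncts, List.mem_singleton] at hψ
    exact hψ ▸ h
  | .tru, ψ, h, hψ => by
    rw [Syn.conjuncts, List.mem_singleton] at hψ
    exact hψ ▸ h
  | .neg φ, ψ, h, hψ => by
    rw [Syn.conjuncts, List.mem_singleton] at hψ
    exact hψ ▸ h
  | .ex _ _ _, _, h, _ => h.1.elim
  | .all _ _ _, _, h, _ => h.1.elim

end Syn.Plain

/-- Nested if-then-else terms whose conditions and leaves are plain over `V`. -/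
inductive IsCaseTree (V : Set (S.Srt × N)) {s : S.Srt} : Term S N s → Prop
  | leaf {t : Term S N s} (ht : t.Plain V) : IsCaseTree V t
  | ite {c : Formula S N} {t u : Term S N s} (hc : c.Plain V) (ht : IsCaseTree V t)
      (hu : IsCaseTree V u) : IsCaseTree V (.ite c t u)

theorem holds_disj {M : Struc S} {α : Asg M N} {l : List (Formula S N)} :
    Holds M α (disj l) ↔ ∃ φ ∈ l, Holds M α φ := by
  induction l with
  | nil => simp [disj, Holds, Syn.eval]
  | cons φ l ih =>
    have h : Holds M α (disj (φ :: l)) ↔ Holds M α φ ∨ Holds M α (disj l) :=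
      show ¬ (¬ Holds M α φ ∧ ¬ Holds M α (disj l)) ↔ _ by tauto
    rw [h, ih]
    simp

namespace IsCaseTree

variable {V W : Set (S.Srt × N)} {s : S.Srt} {F : Term S N s}

theorem subst (h : IsCaseTree V F) {σ : (s : S.Srt) → N → Term S N s}
    (hσ : ∀ s n, (s, n) ∈ V → (σ s n).Plain W) : IsCaseTree W (F.subst σ) := by
  induction h with
  | leaf ht => exact leaf (ht.subst hσ)
  | ite hc _ _ iht ihu => exact ite (hc.subst hσ) iht ihu

/-- A nested if-then-else is a case-defined function: its paths form a `T`-partition. -/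
theorem isCaseDefined (h : IsCaseTree V F) : IsCaseDefined V F := by
  induction h with
  | @leaf t ht =>
    refine ⟨ht.3, [(.tru, t)], ⟨?_, ?_, List.pairwise_singleton _ _⟩, ?_⟩
    · rintro φ hφ
      rw [List.mem_singleton.1 hφ]
      exact ⟨trivial, trivial⟩
    · intro M _ α
      exact holds_disj.2 ⟨_, List.mem_singleton_self _, trivial⟩
    · rintro c hc
      rw [List.mem_singleton.1 hc]
      exact ⟨trivial, ht.3, ht.1, ht.2, fun _ _ _ _ => rfl⟩
  | @ite c t u hc _ _ iht ihu =>
    obtain ⟨hto, ct, ⟨htp, hte, htx⟩, htc⟩ := iht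
    obtain ⟨huo, cu, ⟨hup, hue, hux⟩, huc⟩ := ihu
    refine ⟨⟨hc.3, hto, huo⟩,
      ct.map (fun p => (.and c p.1, p.2)) ++ cu.map (fun p => (.and (.neg c) p.1, p.2)),
      ⟨?_, ?_, ?_⟩, ?_⟩
    · intro φ hφ
      simp only [List.map_append, List.map_map, List.mem_append, List.mem_map,
        Function.comp_def] at hφ
      rcases hφ with ⟨p, hp, rfl⟩ | ⟨p, hp, rfl⟩
      · have := htp p.1 (List.mem_map_of_mem hp)
        exact ⟨⟨hc.1, this.1⟩, hc.2, this.2⟩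
      · have := hup p.1 (List.mem_map_of_mem hp)
        exact ⟨⟨hc.1, this.1⟩, hc.2, this.2⟩
    · intro M hM α
      rw [holds_disj]
      by_cases hcα : Holds M α c
      · obtain ⟨φ, hφ, hφα⟩ := holds_disj.1 (hte M hM α)
        obtain ⟨p, hp, rfl⟩ := List.mem_map.1 hφ
        exact ⟨.and c p.1, List.mem_map.2 ⟨_, List.mem_append_left _
          (List.mem_map_of_mem hp), rfl⟩, hcα, hφα⟩
      · obtain ⟨φ, hφ, hφα⟩ := holds_disj.1 (hue M hM α)
        obtain ⟨p, hp, rfl⟩ := List.mem_map.1 hφ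
        exact ⟨.and (.neg c) p.1, List.mem_map.2 ⟨_, List.mem_append_right _
          (List.mem_map_of_mem hp), rfl⟩, hcα, hφα⟩
    · rw [List.map_append, List.map_map, List.map_map, List.pairwise_append]
      refine ⟨?_, ?_, ?_⟩
      · rw [List.pairwise_map] at htx ⊢
        exact htx.imp fun h M hM α hα => h M hM α ⟨hα.1.2, hα.2.2⟩
      · rw [List.pairwise_map] at hux ⊢
        exact hux.imp fun h M hM α hα => h M hM α ⟨hα.1.2, hα.2.2⟩
      · intro φ hφ ψ hψ
        obtain ⟨p, _, rfl⟩ := List.mem_map.1 hφ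
        obtain ⟨q, _, rfl⟩ := List.mem_map.1 hψ
        exact fun M _ α hα => hα.2.1 hα.1.1
    · intro d hd
      rcases List.mem_append.1 hd with hd | hd
      · obtain ⟨p, hp, rfl⟩ := List.mem_map.1 hd
        obtain ⟨h₁, h₂, h₃, h₄, h₅⟩ := htc p hp
        exact ⟨⟨hc.3, h₁⟩, h₂, h₃, h₄, fun M hM α hα =>
          (if_pos hα.1).trans (h₅ M hM α hα.2)⟩
      · obtain ⟨p, hp, rfl⟩ := List.mem_map.1 hd
        obtain ⟨h₁, h₂, h₃, h₄, h₅⟩ := huc p hp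
        exact ⟨⟨hc.3, h₁⟩, h₂, h₃, h₄, fun M hM α hα =>
          (if_neg hα.1).trans (h₅ M hM α hα.2)⟩

end IsCaseTree

theorem exs_append (l₁ l₂ : List (S.Srt × N)) (φ : Formula S N) :
    exs (l₁ ++ l₂) φ = exs l₁ (exs l₂ φ) :=
  List.foldr_append

theorem subst_conj (l : List (Formula S N)) (σ : (s : S.Srt) → N → Term S N s) :
    (conj l).subst σ = conj (l.map fun φ => φ.subst σ) := by
  induction l with
  | nil => rfl
  | cons φ l ih => exact congrArg (Syn.and (φ.subst σ)) ih

theorem subst_var {k : Kind S.Srt} (φ : Syn S N k) : φ.subst Syn.var = φ := by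
  induction φ <;> simp_all [Syn.subst]

theorem subst_compUpdate (a : S.Comp) (y : N) (G : Term S N (.inl (S.compTgt a)))
    {σ : (s : S.Srt) → N → Term S N s}
    (hσ : σ (.inr (S.compSrc a)) y = .var _ y) :
    (compUpdate a y G).subst σ = compUpdate a y (G.subst σ) := by
  classical
  have h : (fun s' n' => if s' = .inr (S.compSrc a) ∧ n' = y then .var s' n' else σ s' n') = σ := by
    funext s n
    split_ifs with hs
    · obtain ⟨rfl, rfl⟩ := hs
      exact hσ.symm
    · rfl
  have key : (compUpdate a y G).subst σ =
      .all _ y ((Syn.eq (.read .next a (.var _ y)) G).subst σ) :=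
    congrArg (fun τ => Syn.all _ y ((Syn.eq (.read .next a (.var _ y)) G).subst τ)) h
  rw [key]
  exact congrArg (fun t => Syn.all _ y (.eq (.read .next a t) (G.subst σ))) hσ

/-- A transition formula all of whose updates are nested if-then-else terms. -/
theorem isTransitionFormula_of_isCaseTree {e : List (S.Srt × N)} {γ : Formula S N}
    {F : List ((x : S.AVar) × Term S N (S.avSort x))} {y : S.Comp → N}
    {G : List ((a : S.Comp) × Term S N (.inl (S.compTgt a)))}
    (he : e.Nodup) (hγ : γ.Plain {v | v ∈ e})
    (hFn : (F.map Sigma.fst).Nodup) (hFa : ∀ x, x ∈ F.map Sigma.fst)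
    (hF : ∀ f ∈ F, IsCaseTree {v | v ∈ e} f.2)
    (hGn : (G.map Sigma.fst).Nodup) (hGa : ∀ a, a ∈ G.map Sigma.fst)
    (hy : ∀ a, (Sum.inr (S.compSrc a), y a) ∉ e)
    (hG : ∀ g ∈ G, IsCaseTree (insert (Sum.inr (S.compSrc g.1), y g.1) {v | v ∈ e}) g.2) :
    IsTransitionFormula (exs e (.and γ (.and
      (conj (F.map fun f => avarUpdate f.1 f.2))
      (conj (G.map fun g => compUpdate g.1 (y g.1) g.2))))) :=
  ⟨e, γ, F, y, G, he, hγ.1, hγ.2, hγ.3, hFn, hFa, fun f hf => (hF f hf).isCaseDefined, hGn, hGa,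
    fun g hg => ⟨hy g.1, (hG g hg).isCaseDefined⟩, rfl⟩

end RAS

namespace DABModel

open RAS (IsCaseTree)

variable {M : DAB}

/-- A normal variable as an individual variable of the target system. -/
def usrName (v : NVar M.toDataSchema) : M.sig.Srt × Nm := (.inl (.data v.1), .usr v.2)

/-- An index variable of a repository relation as an individual variable of the target system. -/
def repoName (v : M.Repo × Nm) : M.sig.Srt × Nm := (.inr (.repo v.1), v.2)

/-- The individual variable `i`. -/
def idxName : M.sig.Srt × Nm := (.inr .pi, .idx)

section Plain

variable {V : Set (M.sig.Srt × Nm)}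

theorem plain_usrVar {s : M.Ty} {n : ℕ} (h : usrName (s, n) ∈ V) : (usrVar s n).Plain V :=
  .var h

theorem plain_repoVar {R : M.Repo} {e : Nm} (h : repoName (R, e) ∈ V) : (repoVar R e).Plain V :=
  .var h

theorem plain_readRepo {R : M.Repo} {e : Nm} (k : Fin (M.repoArity R))
    (h : repoName (R, e) ∈ V) : (readRepo R k (repoVar R e)).Plain V :=
  .read (S := M.sig) (Component.repo R k) (plain_repoVar h)

theorem plain_constData (s : M.Ty) (d : M.Dom s) : (constData s d).Plain V :=
  .const (S := M.sig) (BasicSort.data s) d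

theorem plain_constLife (l : Label M.Blk) : (constLife l : Tm M .life).Plain V :=
  .const (S := M.sig) BasicSort.life (some l : Option (Label M.Blk))

theorem plain_constBool (b : Bool) : (constBool b : Tm M .bool).Plain V :=
  .const (S := M.sig) BasicSort.bool (some b : Option Bool)

theorem plain_piVar {n : Nm} (h : ((.inr .pi, n) : M.sig.Srt × Nm) ∈ V) :
    (piVar n : RAS.Term M.sig Nm (.inr .pi)).Plain V :=
  .var h

theorem plain_readCase (x : M.CVar) {t : RAS.Term M.sig Nm (.inr .pi)} (h : t.Plain V) :
    (readCase x t).Plain V :=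
  .read (S := M.sig) (Component.case x) h

theorem plain_readLife (B : M.Blk) {t : RAS.Term M.sig Nm (.inr .pi)} (h : t.Plain V) :
    (readLife B t).Plain V :=
  .read (S := M.sig) (Component.life B) h

theorem plain_readError (B : M.Blk) {t : RAS.Term M.sig Nm (.inr .pi)} (h : t.Plain V) :
    (readError B t).Plain V :=
  .read (S := M.sig) (Component.error B) h

theorem plain_trTm (hi : idxName ∈ V) :
    ∀ (s : M.Ty) (t : ETm M.toDataSchema s), (∀ v ∈ t.nvars, usrName v ∈ V) → (trTm s t).Plain V
  | _, .var s n, h => plain_usrVar (h (s, n) (List.mem_singleton_self _))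
  | _, .inst x _, _ => plain_readCase x (plain_piVar hi)
  | _, .const s d, _ => plain_constData s d

theorem plain_trColTm (hi : idxName ∈ V) {R : M.Repo} (hR : repoName (R, .lam) ∈ V) :
    ∀ (s : M.Ty) (t : ColTm M.toDataSchema (ETm M.toDataSchema) R s),
      (∀ v ∈ ColTm.nvars (fun _ => ETm.nvars) s t, usrName v ∈ V) → (trColTm R s t).Plain V
  | _, .old t, h => plain_trTm hi _ t h
  | _, .col k, _ => plain_readRepo k hR

theorem plain_rowEq {R : M.Repo} {e : Nm} (hR : repoName (R, e) ∈ V)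
    {u : (k : Fin (M.repoArity R)) → Tm M (.data (M.repoAttr R k))} (hu : ∀ k, (u k).Plain V) :
    (rowEq R e u).Plain V := by
  refine .conj fun φ hφ => ?_
  obtain ⟨k, rfl⟩ := List.mem_ofFn.1 hφ
  exact .eq (plain_readRepo k hR) (hu k)

theorem mem_flatten_ofFn {α : Type} {n : ℕ} {f : Fin n → List α} {a : α} (k : Fin n)
    (h : a ∈ f k) : a ∈ (List.ofFn f).flatten :=
  List.mem_flatten.2 ⟨f k, List.mem_ofFn.2 ⟨k, rfl⟩, h⟩

theorem plain_trBaseAtom {T : M.Ty → Type} {tr : (s : M.Ty) → T s → Tm M (.data s)}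
    {nv : (s : M.Ty) → T s → List (NVar M.toDataSchema)}
    (htr : ∀ s t, (∀ v ∈ nv s t, usrName v ∈ V) → (tr s t).Plain V) :
    ∀ A : BaseAtom M.toDataSchema T, (∀ v ∈ A.nvars nv, usrName v ∈ V) →
      (trBaseAtom tr A).Plain V
  | .eq s t u, h => .eq (htr s t fun v hv => h v (List.mem_append_left _ hv))
      (htr s u fun v hv => h v (List.mem_append_right _ hv))
  | .cat R t₀ t, h => by
    have h₀ := htr _ t₀ fun v hv => h v (List.mem_append_left _ hv)
    refine .and (.neg (.eq h₀ (plain_constData _ _))) (.conj fun φ hφ => ?_)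
    obtain ⟨k, rfl⟩ := List.mem_ofFn.1 hφ
    exact .eq (htr _ (t k) fun v hv => h v (List.mem_append_right _ (mem_flatten_ofFn k hv)))
      (.app (S := M.sig) ⟨R, k⟩ h₀)

theorem plain_trSign (pos : Bool) {φ : Fm M} (h : φ.Plain V) : (trSign pos φ).Plain V := by
  cases pos
  · exact h.neg
  · exact h

theorem plain_trAtom (hi : idxName ∈ V) {m : ℕ} :
    ∀ A : Atom M.toDataSchema (ETm M.toDataSchema),
      (∀ v ∈ A.nvars fun _ => ETm.nvars, usrName v ∈ V) →
      (∀ R t, A = .repo R t → repoName (R, .fresh m) ∈ V) → (trAtom m A).Plain V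
  | .base A, h, _ => plain_trBaseAtom (plain_trTm hi) A h
  | .repo R t, h, hR => plain_rowEq (hR R t rfl) fun k =>
      plain_trTm hi _ (t k) fun v hv => h v (mem_flatten_ofFn k hv)

theorem plain_trCond (hi : idxName ∈ V) :
    ∀ φ : Cond M.toDataSchema (ETm M.toDataSchema),
      (∀ v ∈ φ.nvars fun _ => ETm.nvars, usrName v ∈ V) → (trCond φ).Plain V
  | .eq s t u, h => .eq (plain_trTm hi s t fun v hv => h v (List.mem_append_left _ hv))
      (plain_trTm hi s u fun v hv => h v (List.mem_append_right _ hv))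
  | .neg φ, h => .neg (plain_trCond hi φ h)
  | .and φ ψ, h => .and (plain_trCond hi φ fun v hv => h v (List.mem_append_left _ hv))
      (plain_trCond hi ψ fun v hv => h v (List.mem_append_right _ hv))

theorem plain_trFilter (hi : idxName ∈ V) {R : M.Repo} (hR : repoName (R, .lam) ∈ V)
    (ψ : Filter M.toDataSchema (ETm M.toDataSchema) R)
    (h : ∀ v ∈ Filter.nvars (fun _ => ETm.nvars) ψ, usrName v ∈ V) : (trFilter R ψ).Plain V := by
  refine .disj fun φ hφ => ?_
  obtain ⟨Q, hQ, rfl⟩ := List.mem_map.1 hφ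
  refine .conj fun φ hφ => ?_
  obtain ⟨L, hL, rfl⟩ := List.mem_map.1 hφ
  exact plain_trSign _ (plain_trBaseAtom (plain_trColTm hi hR) _ fun v hv =>
    h v (List.mem_flatMap.2 ⟨Q, hQ, List.mem_flatMap.2 ⟨L, hL, hv⟩⟩))

theorem isCaseTree_trBranch (hi : idxName ∈ V) {R : M.Repo} (hR : repoName (R, .lam) ∈ V)
    (k : Fin (M.repoArity R)) :
    ∀ η : Branch M.toDataSchema (ETm M.toDataSchema) R,
      (∀ v ∈ η.rowNvars fun _ => ETm.nvars, usrName v ∈ V) →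
      (∀ v ∈ η.filterNvars fun _ => ETm.nvars, usrName v ∈ V) →
      IsCaseTree V (trBranch R k η)
  | .row u, h, _ => .leaf (plain_trColTm hi hR _ (u k) fun v hv => h v (mem_flatten_ofFn k hv))
  | .ite ψ η₁ η₂, h, h' =>
    .ite
      (plain_trFilter hi hR ψ fun v hv =>
        h' v (List.mem_append_left _ (List.mem_append_left _ hv)))
      (isCaseTree_trBranch hi hR k η₁ (fun v hv => h v (List.mem_append_left _ hv))
        fun v hv => h' v (List.mem_append_left _ (List.mem_append_right _ hv)))
      (isCaseTree_trBranch hi hR k η₂ (fun v hv => h v (List.mem_append_right _ hv))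
        fun v hv => h' v (List.mem_append_right _ hv))

theorem plain_atI (hi : idxName ∈ V) (hl : ((.inr .pi, .lam) : M.sig.Srt × Nm) ∈ V) :
    (atI : Fm M).Plain V :=
  .eq (plain_piVar hl) (plain_piVar hi)

/-- The individual variables in `V` and the variable bound by `λ` in an update of `a`. -/
abbrev withLam (V : Set (M.sig.Srt × Nm)) (a : Component M) : Set (M.sig.Srt × Nm) :=
  insert (.inr (M.sig.compSrc a), .lam) V

theorem isCaseTree_trSet (hi : idxName ∈ V) (σ : SetPart M.toDataSchema (ETm M.toDataSchema))
    (h : ∀ v ∈ σ.nvars fun _ => ETm.nvars, usrName v ∈ V) :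
    ∀ g ∈ trSet σ, IsCaseTree (withLam V g.1) g.2 := by
  intro g hg
  obtain ⟨x, hx, hg⟩ := List.mem_filterMap.1 hg
  obtain ⟨v, hv, rfl⟩ := Option.map_eq_some_iff.1 hg
  have hi' : idxName ∈ withLam V (.case x) := Set.mem_insert_of_mem _ hi
  have hl : ((.inr .pi, .lam) : M.sig.Srt × Nm) ∈ withLam V (.case x) := Set.mem_insert _ _
  refine .ite (plain_atI hi' hl) (.leaf (plain_trTm hi' _ v fun w hw => ?_))
    (.leaf (plain_readCase x (plain_piVar hl)))
  refine Set.mem_insert_of_mem _ (h w (List.mem_flatMap.2 ⟨x, hx, ?_⟩))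
  rw [hv]
  exact hw

theorem isCaseTree_rowUpd {R : M.Repo}
    {G : (k : Fin (M.repoArity R)) → Tm M (.data (M.repoAttr R k))}
    (h : ∀ k, IsCaseTree (insert (repoName (R, .lam)) V) (G k)) :
    ∀ g ∈ rowUpd R G, IsCaseTree (withLam V g.1) g.2 := by
  intro g hg
  obtain ⟨k, rfl⟩ := List.mem_ofFn.1 hg
  exact h k

/-- The updates that replace an effect are nested if-then-else terms over the quantified
variables. -/
theorem isCaseTree_trEffect (hi : idxName ∈ V) (sem : M.Repo → InsertSemantics)
    (E : Effect M.toDataSchema (ETm M.toDataSchema))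
    (h : ∀ v ∈ E.valueNvars fun _ => ETm.nvars, usrName v ∈ V)
    (h' : ∀ v ∈ E.filterNvars fun _ => ETm.nvars, usrName v ∈ V)
    (hins : ∀ R u σ, E = .insertSet R u σ → repoName (R, .ins) ∈ V)
    (hdel : ∀ R u σ, E = .deleteSet R u σ → repoName (R, .del) ∈ V) :
    ∀ g ∈ trEffect sem E, IsCaseTree (withLam V g.1) g.2 := by
  have hi' (R : M.Repo) : idxName ∈ insert (repoName (R, .lam)) V := Set.mem_insert_of_mem _ hi
  have hl (R : M.Repo) : repoName (R, .lam) ∈ insert (repoName (R, .lam)) V := Set.mem_insert _ _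
  cases E with
  | set σ => exact isCaseTree_trSet hi σ h
  | insertSet R u σ =>
    intro g hg
    rcases List.mem_append.1 hg with hg | hg
    · refine isCaseTree_rowUpd (fun k => ?_) g hg
      have hu (m) : (trTm _ (u m)).Plain (insert (repoName (R, .lam)) V) :=
        plain_trTm (hi' R) _ _ fun v hv => Set.mem_insert_of_mem _
          (h v (List.mem_append_left _ (mem_flatten_ofFn m hv)))
      refine .ite (.eq (plain_repoVar (hl R))
        (plain_repoVar (Set.mem_insert_of_mem _ (hins R u σ rfl)))) (.leaf (hu k)) ?_
      cases sem R with
      | set =>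
        exact .ite (plain_rowEq (hl R) hu) (.leaf (plain_constData _ _))
          (.leaf (plain_readRepo k (hl R)))
      | multiset => exact .leaf (plain_readRepo k (hl R))
    · exact isCaseTree_trSet hi σ (fun v hv => h v (List.mem_append_right _ hv)) g hg
  | deleteSet R u σ =>
    intro g hg
    rcases List.mem_append.1 hg with hg | hg
    · refine isCaseTree_rowUpd (fun k => ?_) g hg
      exact .ite (.eq (plain_repoVar (hl R))
        (plain_repoVar (Set.mem_insert_of_mem _ (hdel R u σ rfl))))
        (.leaf (plain_constData _ _)) (.leaf (plain_readRepo k (hl R)))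
    · exact isCaseTree_trSet hi σ (fun v hv => h v (List.mem_append_right _ hv)) g hg
  | condUpdate R ψ η₁ η₂ =>
    exact isCaseTree_rowUpd fun k => isCaseTree_trBranch (hi' R) (hl R) k _
      (fun v hv => Set.mem_insert_of_mem _ (h v hv))
      fun v hv => Set.mem_insert_of_mem _ (h' v hv)

theorem plain_effectGuard (hi : idxName ∈ V) (E : Effect M.toDataSchema (ETm M.toDataSchema))
    (h : ∀ v ∈ E.valueNvars fun _ => ETm.nvars, usrName v ∈ V)
    (hins : ∀ R u σ, E = .insertSet R u σ → repoName (R, .ins) ∈ V)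
    (hdel : ∀ R u σ, E = .deleteSet R u σ → repoName (R, .del) ∈ V) :
    ∀ φ ∈ effectGuard E, φ.Plain V := by
  intro φ hφ
  cases E with
  | set σ => simp [effectGuard] at hφ
  | insertSet R u σ =>
    rw [List.mem_singleton.1 hφ]
    exact plain_rowEq (hins R u σ rfl) fun k => plain_constData _ _
  | deleteSet R u σ =>
    rw [List.mem_singleton.1 hφ]
    exact plain_rowEq (hdel R u σ rfl) fun k => plain_trTm hi _ _ fun v hv =>
      h v (List.mem_append_left _ (mem_flatten_ofFn k hv))
  | condUpdate R ψ η₁ η₂ => simp [effectGuard] at hφ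

end Plain

/-! ### The rules -/

namespace Rule

variable (r : Rule M) (sem : M.Repo → InsertSemantics)

/-- The quantified variables of the formula of a rule, given the list of the `y`. -/
def bound (y : List (NVar M.toDataSchema)) : List (M.sig.Srt × Nm) :=
  r.insVars.map repoName ++ (r.delVars.map repoName ++ (r.freshVars.map repoName ++
    (idxName :: y.map usrName)))

theorem ruleFormula_eq_exs_bound (y : List (NVar M.toDataSchema)) (G U : Fm M) :
    ruleFormula r.insVars r.delVars r.freshVars .idx (y.map fun v => (v.1, .usr v.2)) G U =
      RAS.exs (r.bound y) (.and G U) := by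
  unfold bound
  rw [RAS.exs_append, RAS.exs_append, RAS.exs_append, ruleFormula, List.map_map]
  rfl

variable {r}

theorem mem_insVars {R : M.Repo} {n : Nm} (h : (R, n) ∈ r.insVars) : n = .ins := by
  unfold insVars at h
  split at h <;> simp_all

theorem mem_delVars {R : M.Repo} {n : Nm} (h : (R, n) ∈ r.delVars) : n = .del := by
  unfold delVars at h
  split at h <;> simp_all

theorem mem_freshVars {R : M.Repo} {n : Nm} (h : (R, n) ∈ r.freshVars) : ∃ k, n = .fresh k := by
  obtain ⟨p, _, hp⟩ := List.mem_filterMap.1 h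
  split at hp
  · exact ⟨p.2, (congrArg Prod.snd (Option.some.inj hp)).symm⟩
  · cases hp

variable (r)

theorem nodup_insVars : r.insVars.Nodup := by
  unfold insVars
  split <;> simp

theorem nodup_delVars : r.delVars.Nodup := by
  unfold delVars
  split <;> simp

theorem nodup_freshVars : r.freshVars.Nodup := by
  have h : ((List.zipIdx r.cube).map Prod.snd).Nodup := by
    rw [List.zipIdx_map_snd]
    exact List.nodup_range'
  refine List.pairwise_filterMap.2 ((List.pairwise_map.1 h).imp fun {p q} hpq v hv w hw => ?_)
  rintro rfl
  split at hv
  · split at hw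
    · exact hpq (Nm.fresh.inj (congrArg Prod.snd
        (Option.some.inj hv |>.trans (Option.some.inj hw).symm)))
    · cases hw
  · cases hv

theorem repoName_injective : Function.Injective (repoName (M := M)) := by
  rintro ⟨R, n⟩ ⟨R', n'⟩ h
  simp only [repoName, Prod.mk.injEq, Sum.inr.injEq, ArtSort.repo.injEq] at h
  exact Prod.ext h.1 h.2

theorem usrName_injective : Function.Injective (usrName (M := M)) := by
  rintro ⟨R, n⟩ ⟨R', n'⟩ h
  simp only [usrName, Prod.mk.injEq, Sum.inl.injEq, BasicSort.data.injEq, Nm.usr.injEq] at h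
  exact Prod.ext h.1 h.2

theorem nodup_bound {y : List (NVar M.toDataSchema)} (hy : y.Nodup) : (r.bound y).Nodup := by
  unfold bound
  refine List.nodup_append'.2 ⟨r.nodup_insVars.map repoName_injective, List.nodup_append'.2
    ⟨r.nodup_delVars.map repoName_injective, List.nodup_append'.2
      ⟨r.nodup_freshVars.map repoName_injective, List.nodup_cons.2 ⟨?_,
        hy.map usrName_injective⟩, ?_⟩, ?_⟩, ?_⟩
  · simp [idxName, usrName]
  · rintro _ hv hv'
    obtain ⟨⟨R, n⟩, hR, rfl⟩ := List.mem_map.1 hv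
    simp [repoName, idxName, usrName] at hv'
  · rintro _ hv hv'
    obtain ⟨⟨R, n⟩, hR, rfl⟩ := List.mem_map.1 hv
    cases mem_delVars hR
    rcases List.mem_append.1 hv' with hv' | hv'
    · obtain ⟨⟨R', n⟩, hR', h⟩ := List.mem_map.1 hv'
      cases repoName_injective h
      obtain ⟨k, hk⟩ := mem_freshVars hR'
      cases hk
    · simp [repoName, idxName, usrName] at hv'
  · rintro _ hv hv'
    obtain ⟨⟨R, n⟩, hR, rfl⟩ := List.mem_map.1 hv
    cases mem_insVars hR
    rcases List.mem_append.1 hv' with hv' | hv'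
    · obtain ⟨⟨R', n⟩, hR', h⟩ := List.mem_map.1 hv'
      cases repoName_injective h
      cases mem_delVars hR'
    rcases List.mem_append.1 hv' with hv' | hv'
    · obtain ⟨⟨R', n⟩, hR', h⟩ := List.mem_map.1 hv'
      cases repoName_injective h
      obtain ⟨k, hk⟩ := mem_freshVars hR'
      cases hk
    · simp [repoName, idxName, usrName] at hv'

theorem mem_bound {y : List (NVar M.toDataSchema)} {v : M.sig.Srt × Nm} :
    v ∈ r.bound y ↔ (∃ w ∈ r.insVars, repoName w = v) ∨ (∃ w ∈ r.delVars, repoName w = v) ∨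
      (∃ w ∈ r.freshVars, repoName w = v) ∨ v = idxName ∨ ∃ w ∈ y, usrName w = v := by
  simp only [bound, List.mem_append, List.mem_map, List.mem_cons]

theorem lam_notMem_bound (y : List (NVar M.toDataSchema)) (s : M.sig.Srt) :
    (s, Nm.lam) ∉ r.bound y := by
  rw [mem_bound]
  rintro (⟨⟨R, n⟩, hR, h⟩ | ⟨⟨R, n⟩, hR, h⟩ | ⟨⟨R, n⟩, hR, h⟩ | h | ⟨w, _, h⟩)
  · cases mem_insVars hR
    cases congrArg Prod.snd h
  · cases mem_delVars hR
    cases congrArg Prod.snd h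
  · obtain ⟨k, rfl⟩ := mem_freshVars hR
    cases congrArg Prod.snd h
  · cases congrArg Prod.snd h
  · cases congrArg Prod.snd h

/-- The individual variables of the formula of a rule. -/
def vars : Set (M.sig.Srt × Nm) := {v | v ∈ r.bound r.usrVars}

theorem idxName_mem_vars : idxName ∈ r.vars :=
  r.mem_bound.2 (by simp)

variable {r}

theorem usrName_mem_vars {v : NVar M.toDataSchema} (h : v ∈ r.usrVars) : usrName v ∈ r.vars :=
  r.mem_bound.2 (.inr (.inr (.inr (.inr ⟨v, h, rfl⟩))))

theorem ins_mem_vars {E : Effect M.toDataSchema (ETm M.toDataSchema)} (hE : r.eff = some E) :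
    ∀ R u σ, E = .insertSet R u σ → repoName (R, .ins) ∈ r.vars := by
  rintro R u σ rfl
  exact r.mem_bound.2 (.inl ⟨_, by simp [insVars, hE], rfl⟩)

theorem del_mem_vars {E : Effect M.toDataSchema (ETm M.toDataSchema)} (hE : r.eff = some E) :
    ∀ R u σ, E = .deleteSet R u σ → repoName (R, .del) ∈ r.vars := by
  rintro R u σ rfl
  exact r.mem_bound.2 (.inr (.inl ⟨_, by simp [delVars, hE], rfl⟩))

theorem value_mem_vars {E : Effect M.toDataSchema (ETm M.toDataSchema)} (hE : r.eff = some E) :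
    ∀ v ∈ E.valueNvars fun _ => ETm.nvars, usrName v ∈ r.vars := by
  classical
  intro v hv
  refine usrName_mem_vars (List.mem_dedup.2 (List.mem_append_right _ ?_))
  rw [hE]
  exact List.mem_append_left _ hv

theorem filter_mem_vars {E : Effect M.toDataSchema (ETm M.toDataSchema)} (hE : r.eff = some E) :
    ∀ v ∈ E.filterNvars fun _ => ETm.nvars, usrName v ∈ r.vars := by
  classical
  intro v hv
  refine usrName_mem_vars (List.mem_dedup.2 (List.mem_append_right _ ?_))
  rw [hE]
  exact List.mem_append_right _ hv

variable (r)

/-- The rewritten guard is quantifier-free, over the quantified variables. -/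
theorem plain_guardFormula : r.guardFormula.Plain r.vars := by
  classical
  have hi := r.idxName_mem_vars
  refine .conj fun φ hφ => ?_
  simp only [List.mem_append, List.mem_map] at hφ
  rcases hφ with (((⟨p, _, rfl⟩ | ⟨p, _, rfl⟩) | hφ) | ⟨c, hc, rfl⟩) | hφ
  · exact .eq (plain_readLife _ (plain_piVar hi)) (plain_constLife _)
  · exact .eq (.avar (S := M.sig) p.1) (plain_constBool _)
  · obtain ⟨p, hp, rfl⟩ := List.mem_map.1 hφ
    refine plain_trSign _ (plain_trAtom hi _ (fun v hv => ?_) fun R t hA => ?_)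
    · exact usrName_mem_vars (List.mem_dedup.2 (List.mem_append_left _ (List.mem_append_left _
        (List.mem_flatMap.2 ⟨p.1, List.fst_mem_of_mem_zipIdx hp, hv⟩))))
    · refine r.mem_bound.2 (.inr (.inr (.inl ⟨_, List.mem_filterMap.2 ⟨p, hp, ?_⟩, rfl⟩)))
      rw [hA]
  · exact plain_trCond hi c fun v hv => usrName_mem_vars (List.mem_dedup.2
      (List.mem_append_left _ (List.mem_append_right _ (List.mem_flatMap.2 ⟨c, hc, hv⟩))))
  · cases hE : r.eff with
    | none => simp [hE] at hφ
    | some E =>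
      rw [hE] at hφ
      exact plain_effectGuard hi E (value_mem_vars hE) (ins_mem_vars hE) (del_mem_vars hE) φ hφ

/-- The updates of artifact components are nested if-then-else terms. -/
theorem isCaseTree_compUpdates :
    ∀ g ∈ r.compUpdates sem, IsCaseTree (withLam r.vars g.1) g.2 := by
  have hi (a) : idxName ∈ withLam r.vars a := Set.mem_insert_of_mem _ r.idxName_mem_vars
  intro g hg
  rcases List.mem_append.1 hg with hg | hg
  · rcases List.mem_append.1 hg with hg | hg
    · rcases List.mem_append.1 hg with hg | hg
      · obtain ⟨p, _, rfl⟩ := List.mem_map.1 hg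
        have hl : ((.inr .pi, .lam) : M.sig.Srt × Nm) ∈ withLam r.vars (.life p.1) :=
          Set.mem_insert _ _
        exact .ite (plain_atI (hi (.life p.1)) hl) (.leaf (plain_constLife _))
          (.leaf (plain_readLife _ (plain_piVar hl)))
      · obtain ⟨p, _, rfl⟩ := List.mem_map.1 hg
        have hl : ((.inr .pi, .lam) : M.sig.Srt × Nm) ∈ withLam r.vars (.error p.1) :=
          Set.mem_insert _ _
        exact .ite (plain_atI (hi (.error p.1)) hl) (.leaf (plain_constBool _))
          (.leaf (plain_readError _ (plain_piVar hl)))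
    · cases hE : r.eff with
      | none => simp [hE] at hg
      | some E =>
        rw [hE] at hg
        exact isCaseTree_trEffect r.idxName_mem_vars sem E (value_mem_vars hE)
          (filter_mem_vars hE) (ins_mem_vars hE) (del_mem_vars hE) g hg
  · obtain ⟨a, _, rfl⟩ := List.mem_map.1 hg
    exact .leaf (.read (S := M.sig) a (.var (Set.mem_insert _ _)))

theorem isCaseTree_avarUpdates : ∀ f ∈ r.avarUpdates, IsCaseTree r.vars f.2 := by
  intro f hf
  rcases List.mem_append.1 hf with hf | hf
  · obtain ⟨p, _, rfl⟩ := List.mem_map.1 hf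
    exact .leaf (plain_constBool _)
  · obtain ⟨x, _, rfl⟩ := List.mem_map.1 hf
    exact .leaf (.avar (S := M.sig) x)

theorem nodup_usrVars : r.usrVars.Nodup := by
  classical
  exact List.nodup_dedup _

end Rule

/-! ### There is exactly one update for each artifact variable and component -/

/-- A list of assignments that assigns at most one value to each block. -/
def Functional {α β : Type} (l : List (α × β)) : Prop :=
  ∀ a b b', (a, b) ∈ l → (a, b') ∈ l → b = b'

theorem Functional.nodup_dedup_map_fst {α β : Type} [DecidableEq (α × β)] {l : List (α × β)}
    (h : Functional l) : (l.dedup.map Prod.fst).Nodup := by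
  refine List.Nodup.map_on ?_ l.nodup_dedup
  rintro ⟨a, b⟩ hx ⟨a', b'⟩ hy hxy
  cases (show a = a' from hxy)
  rw [h a b b' (List.mem_dedup.1 hx) (List.mem_dedup.1 hy)]

theorem mem_allComponents (a : Component M) : a ∈ allComponents M := by
  cases a <;> simp [allComponents, List.mem_ofFn]

theorem nodup_allComponents (M : DAB) : (allComponents M).Nodup := by
  unfold allComponents
  refine List.nodup_append'.2 ⟨List.nodup_append'.2 ⟨List.nodup_append'.2 ⟨?_, ?_, ?_⟩, ?_, ?_⟩,
    ?_, ?_⟩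
  · exact (Finset.nodup_toList _).map fun _ _ h => Component.case.inj h
  · exact (Finset.nodup_toList _).map fun _ _ h => Component.life.inj h
  · intro a; simp; grind
  · exact (Finset.nodup_toList _).map fun _ _ h => Component.error.inj h
  · intro a; simp; grind
  · refine List.nodup_flatMap.2 ⟨fun R _ => List.nodup_ofFn.2 fun k k' h => ?_,
      (Finset.nodup_toList _).imp fun {R R'} hR a ha ha' => ?_⟩
    · simpa using h
    · obtain ⟨k, rfl⟩ := List.mem_ofFn.1 ha
      obtain ⟨k', h⟩ := List.mem_ofFn.1 ha'
      cases h
      exact hR rfl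
  · intro a; simp [List.mem_ofFn]; grind

theorem fst_mem_trSet {σ : SetPart M.toDataSchema (ETm M.toDataSchema)}
    {a : Component M} (h : a ∈ (trSet σ).map Sigma.fst) : ∃ x, a = .case x := by
  obtain ⟨g, hg, rfl⟩ := List.mem_map.1 h
  obtain ⟨x, _, hg⟩ := List.mem_filterMap.1 hg
  obtain ⟨v, _, rfl⟩ := Option.map_eq_some_iff.1 hg
  exact ⟨x, rfl⟩

theorem nodup_trSet (σ : SetPart M.toDataSchema (ETm M.toDataSchema)) :
    ((trSet σ).map Sigma.fst).Nodup := by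
  refine List.pairwise_map.2 (List.pairwise_filterMap.2 ((Finset.nodup_toList _).imp
    fun {x x'} hx g hg g' hg' h => hx ?_))
  obtain ⟨v, _, rfl⟩ := Option.map_eq_some_iff.1 hg
  obtain ⟨v', _, rfl⟩ := Option.map_eq_some_iff.1 hg'
  exact Component.case.inj h

theorem fst_mem_rowUpd {R : M.Repo}
    {G : (k : Fin (M.repoArity R)) → Tm M (.data (M.repoAttr R k))}
    {a : Component M} (h : a ∈ (rowUpd R G).map Sigma.fst) : ∃ k, a = .repo R k := by
  obtain ⟨g, hg, rfl⟩ := List.mem_map.1 h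
  obtain ⟨k, rfl⟩ := List.mem_ofFn.1 hg
  exact ⟨k, rfl⟩

theorem nodup_rowUpd (R : M.Repo)
    (G : (k : Fin (M.repoArity R)) → Tm M (.data (M.repoAttr R k))) :
    ((rowUpd R G).map Sigma.fst).Nodup := by
  unfold rowUpd
  rw [List.map_ofFn]
  exact List.nodup_ofFn.2 fun k k' h => eq_of_heq (Component.repo.inj h).2

theorem nodup_rowUpd_append_trSet (R : M.Repo)
    (G : (k : Fin (M.repoArity R)) → Tm M (.data (M.repoAttr R k)))
    (σ : SetPart M.toDataSchema (ETm M.toDataSchema)) :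
    ((rowUpd R G ++ trSet σ).map Sigma.fst).Nodup := by
  rw [List.map_append]
  refine List.nodup_append'.2 ⟨nodup_rowUpd R G, nodup_trSet σ, fun a ha ha' => ?_⟩
  obtain ⟨k, rfl⟩ := fst_mem_rowUpd ha
  obtain ⟨x, hx⟩ := fst_mem_trSet ha'
  cases hx

theorem nodup_trEffect (sem : M.Repo → InsertSemantics)
    (E : Effect M.toDataSchema (ETm M.toDataSchema)) :
    ((trEffect sem E).map Sigma.fst).Nodup := by
  cases E with
  | set σ => exact nodup_trSet σ
  | insertSet R u σ => exact nodup_rowUpd_append_trSet R _ σ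
  | deleteSet R u σ => exact nodup_rowUpd_append_trSet R _ σ
  | condUpdate R ψ η₁ η₂ => exact nodup_rowUpd R _

theorem fst_mem_trEffect {sem : M.Repo → InsertSemantics}
    {E : Effect M.toDataSchema (ETm M.toDataSchema)}
    {a : Component M} (h : a ∈ (trEffect sem E).map Sigma.fst) :
    (∃ x, a = .case x) ∨ ∃ R k, a = .repo R k := by
  cases E with
  | set σ => exact .inl (fst_mem_trSet h)
  | insertSet R u σ =>
    rw [trEffect, List.map_append, List.mem_append] at h
    exact h.elim (fun h => .inr ⟨R, fst_mem_rowUpd h⟩) fun h => .inl (fst_mem_trSet h)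
  | deleteSet R u σ =>
    rw [trEffect, List.map_append, List.mem_append] at h
    exact h.elim (fun h => .inr ⟨R, fst_mem_rowUpd h⟩) fun h => .inl (fst_mem_trSet h)
  | condUpdate R ψ η₁ η₂ => exact .inr ⟨R, fst_mem_rowUpd h⟩

namespace Rule

variable (r : Rule M) (sem : M.Repo → InsertSemantics)

theorem nodup_avarUpdates (h : Functional r.flagUpd) :
    (r.avarUpdates.map Prod.fst).Nodup := by
  classical
  unfold avarUpdates
  rw [List.map_append, List.map_map, List.map_map]
  refine List.nodup_append'.2 ⟨?_, ?_, ?_⟩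
  · exact h.nodup_dedup_map_fst
  · exact ((Finset.nodup_toList _).filter _).map fun _ _ h => h
  · intro x hx hx'
    obtain ⟨p, hp, rfl⟩ := List.mem_map.1 hx
    obtain ⟨z, hz, hzp⟩ := List.mem_map.1 hx'
    have hz' := (List.mem_filter.1 hz).2
    cases (show z = p.1 from hzp)
    simp only [decide_eq_true_eq] at hz'
    exact hz' (List.mem_map_of_mem (List.mem_dedup.1 hp))

theorem mem_avarUpdates (x : M.Blk) : x ∈ r.avarUpdates.map Prod.fst := by
  classical
  unfold avarUpdates
  rw [List.map_append, List.map_map, List.map_map, List.mem_append]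
  by_cases hx : x ∈ r.flagUpd.map Prod.fst
  · obtain ⟨p, hp, rfl⟩ := List.mem_map.1 hx
    exact .inl (List.mem_map.2 ⟨p, List.mem_dedup.2 hp, rfl⟩)
  · exact .inr (List.mem_map.2 ⟨x, List.mem_filter.2 ⟨by simp, by simpa using hx⟩, rfl⟩)

theorem nodup_mentioned (hl : Functional r.lifeUpd) (hf : Functional r.instFlagUpd) :
    ((r.mentioned sem).map Sigma.fst).Nodup := by
  classical
  unfold mentioned
  rw [List.map_append, List.map_append, List.map_map, List.map_map]
  refine List.nodup_append'.2 ⟨List.nodup_append'.2 ⟨?_, ?_, ?_⟩, ?_, ?_⟩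
  · have := hl.nodup_dedup_map_fst.map (f := Component.life (M := M))
      fun _ _ h => Component.life.inj h
    rw [List.map_map] at this
    exact this
  · have := hf.nodup_dedup_map_fst.map (f := Component.error (M := M))
      fun _ _ h => Component.error.inj h
    rw [List.map_map] at this
    exact this
  · intro a ha ha'
    obtain ⟨p, _, rfl⟩ := List.mem_map.1 ha
    obtain ⟨q, _, h⟩ := List.mem_map.1 ha'
    cases h
  · cases r.eff with
    | none => exact List.nodup_nil
    | some E => exact nodup_trEffect sem E
  · intro a ha ha'
    cases hE : r.eff with
    | none => simp [hE] at ha'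
    | some E =>
      rw [hE] at ha'
      rcases List.mem_append.1 ha with ha | ha <;> obtain ⟨p, _, rfl⟩ := List.mem_map.1 ha <;>
      rcases fst_mem_trEffect ha' with ⟨x, h⟩ | ⟨R, k, h⟩ <;> cases h

theorem nodup_compUpdates (hl : Functional r.lifeUpd) (hf : Functional r.instFlagUpd) :
    ((r.compUpdates sem).map Sigma.fst).Nodup := by
  classical
  unfold compUpdates
  rw [List.map_append, List.map_map]
  refine List.nodup_append'.2 ⟨r.nodup_mentioned sem hl hf,
    ((nodup_allComponents M).filter _).map fun _ _ h => h, fun a ha ha' => ?_⟩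
  obtain ⟨b, hb, hba⟩ := List.mem_map.1 ha'
  cases (show b = a from hba)
  have hb' := (List.mem_filter.1 hb).2
  simp only [decide_eq_true_eq] at hb'
  exact hb' ha

theorem mem_compUpdates (a : Component M) : a ∈ (r.compUpdates sem).map Sigma.fst := by
  classical
  unfold compUpdates
  rw [List.map_append, List.map_map, List.mem_append]
  by_cases ha : a ∈ (r.mentioned sem).map Sigma.fst
  · exact .inl ha
  · exact .inr (List.mem_map.2 ⟨a, List.mem_filter.2
      ⟨mem_allComponents a, by simpa using ha⟩, rfl⟩)

end Rule

/-! ### The produced rules assign at most one value to each control variable -/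

theorem mem_subBlocks {A B : M.Blk} :
    B ∈ M.subBlocks A ↔ Relation.TransGen (fun P C => C ∈ (M.shape P).children) A B := by
  simp [DAB.subBlocks]

theorem notMem_subBlocks_self (A : M.Blk) : A ∉ M.subBlocks A :=
  fun h => M.acyclic A (mem_subBlocks.1 h)

theorem notMem_children_self (B : M.Blk) : B ∉ (M.shape B).children :=
  fun h => M.acyclic B (.single h)

/-- A child of a block below `H` is different from `H`. -/
theorem ne_of_mem_children {H B C : M.Blk}
    (hB : Relation.ReflTransGen (fun P C => C ∈ (M.shape P).children) H B)
    (hC : C ∈ (M.shape B).children) : C ≠ H := by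
  rintro rfl
  exact M.acyclic C (.tail' hB hC)

theorem functional_nil {α β : Type} : Functional ([] : List (α × β)) := by
  simp [Functional]

theorem functional_singleton {α β : Type} (p : α × β) : Functional [p] := by
  rintro a b b' h h'
  rw [List.mem_singleton] at h h'
  exact congrArg Prod.snd (h.trans h'.symm)

/-- The reset of all the sub-blocks of `H` together with the raising of the error at `H`. -/
theorem functional_reset {H : M.Blk} {l : List (M.Blk × Label M.Blk)}
    (h : ∀ p ∈ l, p = (H, .error H) ∨ p.1 ≠ H ∧ p.2 = .idle) : Functional l := by
  intro a b b' hb hb'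
  rcases h _ hb with h₁ | h₁ <;> rcases h _ hb' with h₂ | h₂ <;> grind

theorem functional_reset_append {H C : M.Blk} (hC : C ≠ H) :
    Functional ((C, .idle) :: (M.subBlocks H).map (·, Label.idle) ++ [(H, .error H)]) := by
  refine functional_reset (H := H) fun p hp => ?_
  have := notMem_subBlocks_self H
  simp only [List.cons_append, List.mem_cons, List.mem_append, List.mem_map,
    List.not_mem_nil, or_false] at hp
  grind

theorem Produces.functional_lifeUpd {B : M.Blk} {r : Rule M} (hr : Produces M B r) :
    Functional r.lifeUpd := by
  have hs := notMem_children_self B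
  have hn := M.children_nodup B
  cases hr
  case err₃ φ B₁ H I hB =>
    exact functional_reset_append (ne_of_mem_children
      (M.error_caught B H (.inl ⟨_, _, hB⟩)).1 (by simp [hB, Shape.children]))
  case err₃alt φ B₁ H I hB =>
    intro a b b' hb hb'
    simp only [List.mem_cons, List.mem_map] at hb hb'
    grind
  case errEvent₂ E₁ E₂ H α I hB hE =>
    exact functional_reset_append (ne_of_mem_children
      (M.error_caught B H (.inr ⟨_, _, hB⟩)).1 (by simp [hB, Shape.children]))
  case raise A l I hB hl =>
    refine functional_reset (H := A) fun p hp => ?_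
    have := notMem_subBlocks_self A
    simp only [List.mem_cons, List.mem_map] at hp
    grind
  case nseqFirst Bs h B₁ I hB h₁ =>
    have : B₁ ∈ Bs := List.mem_of_mem_head? h₁
    simp only [hB, Shape.children] at hs
    simp only [Functional, List.mem_cons, List.not_mem_nil, or_false]
    grind
  case nseqLast Bs h Bn I hB h₁ =>
    have : Bn ∈ Bs := List.mem_of_mem_getLast? h₁
    simp only [hB, Shape.children] at hs
    simp only [Functional, List.mem_cons, List.not_mem_nil, or_false]
    grind
  case nseqNext Bs h k C C' I hB hC hC' =>
    simp only [hB, Shape.children] at hn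
    have hne : C ≠ C' := by
      rintro rfl
      have hk := (List.getElem?_eq_some_iff.1 hC).1
      have := (List.getElem?_inj hk hn).1 (hC.trans hC'.symm)
      omega
    simp only [Functional, List.mem_cons, List.not_mem_nil, or_false]
    grind
  case errEvent₁ => exact functional_singleton _
  all_goals
    simp only [*, Shape.children, List.nodup_cons, List.mem_cons, List.not_mem_nil, or_false,
      not_or] at hs hn
    simp only [Functional, List.mem_cons, List.not_mem_nil, or_false]
    grind

theorem Produces.functional_instFlagUpd {B : M.Blk} {r : Rule M} (hr : Produces M B r) :
    Functional r.instFlagUpd := by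
  cases hr <;> first | exact functional_nil | exact functional_singleton _

theorem Produces.functional_flagUpd {B : M.Blk} {r : Rule M} (hr : Produces M B r) :
    Functional r.flagUpd := by
  cases hr <;> first | exact functional_nil | exact functional_singleton _

/-! ### The formulae of a rule -/

namespace Rule

variable (r : Rule M) (sem : M.Repo → InsertSemantics)

/-- The formula of a rule under a substitution that does not touch the variable bound by `λ` is a
transition formula, if the substituted terms are plain over the remaining variables. -/
theorem isTransitionFormula_subst (hl : Functional r.lifeUpd) (hf : Functional r.instFlagUpd)
    (ha : Functional r.flagUpd) {y : List (NVar M.toDataSchema)} (hy : y.Nodup)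
    {τ : (s : M.sig.Srt) → Nm → RAS.Term M.sig Nm s}
    (hlam : ∀ a : ArtSort M, τ (.inr a) .lam = .var _ .lam)
    (hτ : ∀ W : Set (M.sig.Srt × Nm), (∀ v ∈ r.bound y, v ∈ W) →
      ∀ s n, (s, n) ∈ r.vars → (τ s n).Plain W) :
    RAS.IsTransitionFormula (RAS.exs (r.bound y)
      (.and (r.guardFormula.subst τ) ((r.updateFormula sem).subst τ))) := by
  have hU : (r.updateFormula sem).subst τ = .and
      (RAS.conj ((r.avarUpdates.map fun f =>
        (⟨f.1, f.2.subst τ⟩ : (x : M.sig.AVar) × RAS.Term M.sig Nm (M.sig.avSort x))).map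
          fun f => RAS.avarUpdate f.1 f.2))
      (RAS.conj (((r.compUpdates sem).map fun g =>
        (⟨g.1, g.2.subst τ⟩ : CompUpd M)).map
          fun g => RAS.compUpdate (S := M.sig) g.1 .lam g.2)) := by
    refine congrArg₂ RAS.Syn.and ?_ ?_
    · rw [RAS.subst_conj, List.map_map, List.map_map]
      rfl
    · rw [RAS.subst_conj, List.map_map, List.map_map]
      exact congrArg RAS.conj (List.map_congr_left fun g _ =>
        RAS.subst_compUpdate (S := M.sig) (N := Nm) g.1 .lam g.2 (σ := τ) (hlam _))
  rw [hU]
  refine RAS.isTransitionFormula_of_isCaseTree (S := M.sig) (y := fun _ => .lam)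
    (r.nodup_bound hy) (r.plain_guardFormula.subst (hτ _ fun _ h => h)) ?_ ?_ ?_ ?_ ?_
    (fun a => r.lam_notMem_bound y _) ?_
  · rw [List.map_map]
    exact r.nodup_avarUpdates ha
  · rw [List.map_map]
    exact r.mem_avarUpdates
  · intro f hf
    obtain ⟨f, hf', rfl⟩ := List.mem_map.1 hf
    exact (r.isCaseTree_avarUpdates f hf').subst (hτ _ fun _ h => h)
  · rw [List.map_map]
    exact r.nodup_compUpdates sem hl hf
  · rw [List.map_map]
    exact r.mem_compUpdates sem
  · intro g hg
    obtain ⟨g, hg', rfl⟩ := List.mem_map.1 hg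
    refine (r.isCaseTree_compUpdates sem g hg').subst fun s n hsn => ?_
    rcases hsn with hsn | hsn
    · cases hsn
      rw [hlam]
      exact .var (Set.mem_insert _ _)
    · exact hτ _ (fun v hv => Set.mem_insert_of_mem _ hv) s n hsn

theorem isTransitionFormula_toFormula (hl : Functional r.lifeUpd)
    (hf : Functional r.instFlagUpd) (ha : Functional r.flagUpd) :
    RAS.IsTransitionFormula (r.toFormula sem) := by
  have h := r.isTransitionFormula_subst sem hl hf ha r.nodup_usrVars (τ := RAS.Syn.var)
    (fun _ => rfl) fun W hW s n hsn => .var (hW _ hsn)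
  rwa [RAS.subst_var, RAS.subst_var, ← ruleFormula_eq_exs_bound] at h

open Classical in
/-- The variables `y` that are not eliminated. -/
noncomputable def keptVars : List (NVar M.toDataSchema) :=
  r.usrVars.filter fun y => ¬ ∃ t, r.IsDefinition y t

variable {r}

theorem repoName_mem_bound {w : M.Repo × Nm} {y y' : List (NVar M.toDataSchema)}
    (h : repoName w ∈ r.bound y) : repoName w ∈ r.bound y' := by
  rw [mem_bound] at h ⊢
  rcases h with h | h | h | h | ⟨v, _, h⟩
  · exact .inl h
  · exact .inr (.inl h)
  · exact .inr (.inr (.inl h))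
  · cases congrArg Prod.fst h
  · cases congrArg Prod.fst h

/-- A term `a_R[e]` that defines a variable is over the variables that are kept. -/
theorem IsDefinition.plain {v : NVar M.toDataSchema} {t : Tm M (.data v.1)}
    (h : r.IsDefinition v t) {y : List (NVar M.toDataSchema)} {W : Set (M.sig.Srt × Nm)}
    (hW : ∀ w ∈ r.bound y, w ∈ W) : t.Plain W := by
  obtain ⟨s, n⟩ := v
  obtain ⟨⟨R, k, e, heq⟩, hmem⟩ := h
  cases heq
  have hR : repoName (R, e) ∈ r.vars := (r.plain_guardFormula.of_mem_conjuncts hmem).isOver.1.2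
  exact plain_readRepo k (hW _ (repoName_mem_bound hR))

variable (r)

theorem plain_elim {W : Set (M.sig.Srt × Nm)} (hW : ∀ w ∈ r.bound r.keptVars, w ∈ W)
    (s : M.sig.Srt) (n : Nm) (h : (s, n) ∈ r.vars) : (r.elim s n).Plain W := by
  classical
  have hrepo {w : M.Repo × Nm} (hw : repoName w = (s, n)) : (r.elim s n).Plain W := by
    cases hw
    exact plain_repoVar (hW _ (repoName_mem_bound h))
  rcases r.mem_bound.1 h with ⟨w, _, hw⟩ | ⟨w, _, hw⟩ | ⟨w, _, hw⟩ | hw | ⟨v, hv, hw⟩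
  · exact hrepo hw
  · exact hrepo hw
  · exact hrepo hw
  · cases hw
    exact plain_piVar (hW _ (r.mem_bound.2 (by simp [idxName])))
  · cases hw
    by_cases ht : ∃ t, r.IsDefinition v t
    · have : r.elim (.inl (.data v.1)) (.usr v.2) = ht.choose := dif_pos ht
      rw [this]
      exact ht.choose_spec.plain hW
    · have : r.elim (.inl (.data v.1)) (.usr v.2) = usrVar v.1 v.2 := dif_neg ht
      rw [this]
      exact plain_usrVar (hW _ (r.mem_bound.2 (.inr (.inr (.inr (.inr
        ⟨v, List.mem_filter.2 ⟨hv, by simpa using ht⟩, rfl⟩))))))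

theorem isTransitionFormula_toReducedFormula (hl : Functional r.lifeUpd)
    (hf : Functional r.instFlagUpd) (ha : Functional r.flagUpd) :
    RAS.IsTransitionFormula (r.toReducedFormula sem) := by
  have h := r.isTransitionFormula_subst sem hl hf ha (y := r.keptVars) (τ := r.elim)
    (r.nodup_usrVars.filter _) (fun _ => rfl) fun W hW s n hsn => r.plain_elim hW s n hsn
  rwa [← ruleFormula_eq_exs_bound] at h

theorem hasRuleForm_toFormula : HasRuleForm (r.toFormula sem) :=
  ⟨_, _, _, _, _, _, _, r.plain_guardFormula.quantifierFree, rfl⟩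

theorem hasRuleForm_toReducedFormula : HasRuleForm (r.toReducedFormula sem) :=
  ⟨_, _, _, _, _, _, _,
    (r.plain_guardFormula.subst (r.plain_elim fun _ h => h)).quantifierFree, rfl⟩

end Rule

end DABModel

theorem translated_dab_rule_fits_ras_transition_format
    (M : DABModel.DAB) (sem : M.Repo → DABModel.InsertSemantics) (B : M.Blk)
    (r : DABModel.Rule M) (hr : DABModel.Produces M B r) :
    (DABModel.HasRuleForm (r.toFormula sem) ∧
      RAS.IsTransitionFormula (r.toFormula sem)) ∧
    (DABModel.HasRuleForm (r.toReducedFormula sem) ∧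
      RAS.IsTransitionFormula (r.toReducedFormula sem)) := by
  have hl := hr.functional_lifeUpd
  have hf := hr.functional_instFlagUpd
  have ha := hr.functional_flagUpd
  exact ⟨⟨r.hasRuleForm_toFormula sem, r.isTransitionFormula_toFormula sem hl hf ha⟩,
    ⟨r.hasRuleForm_toReducedFormula sem, r.isTransitionFormula_toReducedFormula sem hl hf ha⟩⟩
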